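/- arXiv:2105.11887 — 2 statements merged into one kernel-verified Lean document; each statement's English description precedes it below -/
import Mathlib

section
/- Let G=(V,w,m,d) be a connected, locally finite weighted graph with a path metric d with finite balls and non-negative Ollivier curvature, i.e. κ(x,y) ≥ 0 for all x∼y. If inf_{x∈V} m(x) > 0, then the number of ends of G is at most two, i.e. G does not have at least three ends. -/
open Filter

namespace SalamiPaper

variable {V : Type*}

/-- Locally finite: every vertex has finitely many neighbors. -/
def LocallyFinite (w : V → V → ℝ) : Prop := ∀ x : V, {y | 0 < w x y}.Finite

/-- Connectedness of the weighted graph: any two vertices are joined by a path. -/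
def GraphConnected (w : V → V → ℝ) : Prop :=
  ∀ x y : V, Relation.ReflTransGen (fun a b => 0 < w a b) x y

/-- The weighted graph Laplacian `Δf(x) = (1/m(x)) ∑_y w(x,y)(f(y)-f(x))`. -/
noncomputable def lap (w : V → V → ℝ) (m : V → ℝ) (f : V → ℝ) (x : V) : ℝ :=
  (m x)⁻¹ * ∑ᶠ y, w x y * (f y - f x)

/-- The vertex degree `Deg(x) = (1/m(x)) ∑_y w(x,y)`. -/
noncomputable def deg (w : V → V → ℝ) (m : V → ℝ) (x : V) : ℝ :=
  (m x)⁻¹ * ∑ᶠ y, w x y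

/-- The set of `d`-lengths of adjacency paths from `x` to `y`. -/
def pathLens (w : V → V → ℝ) (d : V → V → ℝ) (x y : V) : Set ℝ :=
  {L | ∃ (n : ℕ) (p : ℕ → V), p 0 = x ∧ p n = y ∧
    (∀ i < n, 0 < w (p i) (p (i + 1))) ∧
    L = ∑ i ∈ Finset.range n, d (p i) (p (i + 1))}

/-- `d` is a path metric on the graph with edge weight `w`. -/
def IsPathMetric (w : V → V → ℝ) (d : V → V → ℝ) : Prop :=
  (∀ x, d x x = 0) ∧ (∀ x y, x ≠ y → 0 < d x y) ∧ (∀ x y, d x y = d y x) ∧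
  (∀ x y z, d x z ≤ d x y + d y z) ∧
  (∀ x y, d x y = sInf (pathLens w d x y))

/-- All balls are finite. -/
def FiniteBalls (d : V → V → ℝ) : Prop := ∀ (x : V) (R : ℝ), {y | d x y ≤ R}.Finite

/-- The combinatorial graph distance (as a real number). -/
noncomputable def combDist (w : V → V → ℝ) (x y : V) : ℝ :=
  sInf {L | ∃ (n : ℕ) (p : ℕ → V), p 0 = x ∧ p n = y ∧
    (∀ i < n, 0 < w (p i) (p (i + 1))) ∧ L = (n : ℝ)}

/-- `Lip(1)`: the 1-Lipschitz functions with respect to `d`. -/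
def Lip1 (d : V → V → ℝ) (f : V → ℝ) : Prop := ∀ x y, f y - f x ≤ d x y

/-- The Ollivier curvature
`κ(x,y) = (1/d(x,y)) inf{Δf(x) - Δf(y) : f ∈ Lip(1), f(y)-f(x) = d(x,y)}`. -/
noncomputable def kappa (w : V → V → ℝ) (m : V → ℝ) (d : V → V → ℝ) (x y : V) : ℝ :=
  (d x y)⁻¹ * sInf {c | ∃ f : V → ℝ, Lip1 d f ∧ f y - f x = d x y ∧
    c = lap w m f x - lap w m f y}

/-- `m(A) = ∞`: the total measure of `A` is infinite. -/
def InfVolume (m : V → ℝ) (A : Set V) : Prop :=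
  ∀ c : ℝ, ∃ F : Finset V, ↑F ⊆ A ∧ c < ∑ x ∈ F, m x

/-- A salami partition `(X,Y,K)`. -/
def SalamiPartition (w : V → V → ℝ) (m : V → ℝ) (X Y K : Set V) : Prop :=
  X ∪ Y ∪ K = Set.univ ∧ Disjoint X Y ∧ Disjoint X K ∧ Disjoint Y K ∧
  K.Finite ∧ (∀ x ∈ X, ∀ y ∈ Y, w x y = 0) ∧ InfVolume m X ∧ InfVolume m Y

/-- Reachability inside a subset `A` of the vertex set. -/
def reachIn (w : V → V → ℝ) (A : Set V) : V → V → Prop :=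
  Relation.ReflTransGen (fun a b => a ∈ A ∧ b ∈ A ∧ 0 < w a b)

/-- The induced subgraph on `A` is connected. -/
def ConnectedIn (w : V → V → ℝ) (A : Set V) : Prop :=
  ∀ x ∈ A, ∀ y ∈ A, reachIn w A x y

/-- A connected salami partition: `K` induces a connected subgraph. -/
def ConnectedSalamiPartition (w : V → V → ℝ) (m : V → ℝ) (X Y K : Set V) : Prop :=
  SalamiPartition w m X Y K ∧ ConnectedIn w K

/-- The basic standing assumptions on a weighted graph `G = (V,w,m,d)`:
countable vertex set, symmetric non-negative edge weight vanishing on the diagonal,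
positive vertex measure, local finiteness, connectedness,
`d` a path metric with finite balls. -/
def IsGraphBase (w : V → V → ℝ) (m : V → ℝ) (d : V → V → ℝ) : Prop :=
  Countable V ∧ (∀ x y, w x y = w y x) ∧ (∀ x y, 0 ≤ w x y) ∧ (∀ x, w x x = 0) ∧
  (∀ x, 0 < m x) ∧ LocallyFinite w ∧ GraphConnected w ∧
  IsPathMetric w d ∧ FiniteBalls d

/-- Non-negative Ollivier curvature on all edges. -/
def NonnegCurv (w : V → V → ℝ) (m : V → ℝ) (d : V → V → ℝ) : Prop :=
  ∀ x y, 0 < w x y → 0 ≤ kappa w m d x y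

/-- A salami: a connected, locally finite weighted graph with a path metric with
finite balls, non-negative Ollivier curvature, admitting a salami partition. -/
def IsSalami (w : V → V → ℝ) (m : V → ℝ) (d : V → V → ℝ) : Prop :=
  IsGraphBase w m d ∧ NonnegCurv w m d ∧ ∃ X Y K : Set V, SalamiPartition w m X Y K

/-- `G` has at least `n` ends: there is a finite set `K` such that `V ∖ K` has at
least `n` infinite connected components. -/
def atLeastEnds (w : V → V → ℝ) (n : ℕ) : Prop :=
  ∃ K : Set V, K.Finite ∧ ∃ x : Fin n → V,
    (∀ i, x i ∉ K) ∧ (∀ i, {y | reachIn w Kᶜ (x i) y}.Infinite) ∧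
    (∀ i j, i ≠ j → ¬ reachIn w Kᶜ (x i) (x j))

/-- `Lip(1,K)`: functions that are 1-Lipschitz on `K`. -/
def Lip1On (d : V → V → ℝ) (K : Set V) (f : V → ℝ) : Prop :=
  ∀ x ∈ K, ∀ y ∈ K, f y - f x ≤ d x y

open Classical in
/-- The extremal Lipschitz extension operator `S(P)` of the salami partition
`P = (X,Y,K)`. -/
noncomputable def Sop (d : V → V → ℝ) (X Y K : Set V) (f : V → ℝ) : V → ℝ :=
  fun v =>
    if v ∈ K then f v
    else if v ∈ X then sSup {c | ∃ u ∈ K, c = f u - d v u}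
    else sInf {c | ∃ u ∈ K, c = f u + d v u}

/-- `ℱ(P) = S(P)(Lip(1,K))`. -/
def calF (d : V → V → ℝ) (X Y K : Set V) : Set (V → ℝ) :=
  {g | ∃ f : V → ℝ, Lip1On d K f ∧ g = Sop d X Y K f}

/-- `ℋ(P)`: the harmonic functions in `ℱ(P)`. -/
def calH (w : V → V → ℝ) (m : V → ℝ) (d : V → V → ℝ) (X Y K : Set V) :
    Set (V → ℝ) :=
  {g | g ∈ calF d X Y K ∧ ∀ x, lap w m g x = 0}

/-- `∇₊f(x) = max_{y∼x} (f(y)-f(x))/d(x,y)`. -/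
noncomputable def gradPlus (w : V → V → ℝ) (d : V → V → ℝ) (f : V → ℝ) (x : V) : ℝ :=
  sSup {c | ∃ y, 0 < w x y ∧ c = (f y - f x) / d x y}

/-- `∇₋f(x) = max_{y∼x} (f(x)-f(y))/d(x,y)`. -/
noncomputable def gradMinus (w : V → V → ℝ) (d : V → V → ℝ) (f : V → ℝ) (x : V) : ℝ :=
  sSup {c | ∃ y, 0 < w x y ∧ c = (f x - f y) / d x y}

/-- `|∇f|(x) = max_{y∼x} |f(y)-f(x)|/d(x,y)`. -/
noncomputable def gradAbs (w : V → V → ℝ) (d : V → V → ℝ) (f : V → ℝ) (x : V) : ℝ :=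
  sSup {c | ∃ y, 0 < w x y ∧ c = |f y - f x| / d x y}

/-- Recurrence: for every `ε > 0` there is a finitely supported `f` with
`‖f‖∞ = 1` and `-⟨f, Δf⟩ < ε`. -/
def Recurrent (w : V → V → ℝ) (m : V → ℝ) : Prop :=
  ∀ ε : ℝ, 0 < ε → ∃ f : V → ℝ, (Function.support f).Finite ∧
    (∀ x, |f x| ≤ 1) ∧ (∃ x, |f x| = 1) ∧
    -(∑ᶠ x, f x * lap w m f x * m x) < ε

open Classical in
/-- `∑_{x,y : f(y) < 0 ≤ f(x)} w(x,y)(f(x)-f(y))`. -/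
noncomputable def cutSum (w : V → V → ℝ) (f : V → ℝ) : ℝ :=
  ∑ᶠ p : V × V, if f p.2 < 0 ∧ 0 ≤ f p.1 then w p.1 p.2 * (f p.1 - f p.2) else 0

/-- Subexponential growth: `max_{B_r(x)} |u| = e^{o(r)}` as `r → ∞`. -/
def SubexpGrowth (d : V → V → ℝ) (x : V) (u : V → ℝ) : Prop :=
  Filter.Tendsto
    (fun r : ℕ => Real.log (sSup {c | ∃ y, d x y ≤ (r : ℝ) ∧ c = |u y|}) / (r : ℝ))
    Filter.atTop (nhds 0)

/-- A `1`-Lipschitz function which is the smallest Lipschitz extension of its values on `K` inside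
`X`, and the largest one outside of `X`. -/
def IsExtremal (d : V → V → ℝ) (X : Set V) (K : Finset V) (f : V → ℝ) : Prop :=
  Lip1 d f ∧ (∀ x ∈ X, ∃ u ∈ K, f u - f x = d x u) ∧ (∀ x ∉ X, ∃ u ∈ K, f x - f u = d x u)

/-- The vertices of `K` separate `X` from its complement. -/
def Separates (w : V → V → ℝ) (X : Set V) (K : Finset V) : Prop :=
  ∀ x ∈ X, ∀ y ∉ X, 0 < w x y → x ∈ K ∨ y ∈ K

/-- Every nontrivial subset of `K` is joined to its complement in `K` by an edge. -/
def CutConnected (w : V → V → ℝ) (K : Finset V) : Prop :=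
  ∀ A ⊂ K, A.Nonempty → ∃ a ∈ A, ∃ k ∈ K, k ∉ A ∧ 0 < w a k

section Laplacian

variable {w : V → V → ℝ} {m : V → ℝ} {d : V → V → ℝ}

theorem lap_eq_sum (hw : ∀ x y, 0 ≤ w x y) (f : V → ℝ) (x : V) (s : Finset V)
    (hs : ∀ y, 0 < w x y → y ∈ s) :
    lap w m f x = (m x)⁻¹ * ∑ y ∈ s, w x y * (f y - f x) := by
  unfold lap
  congr 1
  apply finsum_eq_sum_of_support_subset
  intro y hy
  refine hs y (lt_of_le_of_ne (hw x y) ?_)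
  rintro h
  simp [← h] at hy

theorem IsGraphBase.exists_neighborFinset (hB : IsGraphBase w m d) (x : V) :
    ∃ s : Finset V, ∀ y, 0 < w x y ↔ y ∈ s :=
  ⟨(hB.2.2.2.2.2.1 x).toFinset, fun y => by simp⟩

theorem lap_add (hB : IsGraphBase w m d) (f g : V → ℝ) (x : V) :
    lap w m (fun v => f v + g v) x = lap w m f x + lap w m g x := by
  obtain ⟨s, hs⟩ := hB.exists_neighborFinset x
  have hs' := fun y => (hs y).1
  rw [lap_eq_sum hB.2.2.1 _ x s hs', lap_eq_sum hB.2.2.1 f x s hs',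
    lap_eq_sum hB.2.2.1 g x s hs', ← mul_add, ← Finset.sum_add_distrib]
  congr 1
  exact Finset.sum_congr rfl fun y _ => by ring

theorem lap_sub_const (f : V → ℝ) (c : ℝ) (x : V) :
    lap w m (fun v => f v - c) x = lap w m f x := by
  simp [lap]

theorem continuous_lap (hB : IsGraphBase w m d) (x : V) :
    Continuous fun f : V → ℝ => lap w m f x := by
  obtain ⟨s, hs⟩ := hB.exists_neighborFinset x
  simp_rw [lap_eq_sum hB.2.2.1 _ x s fun y => (hs y).1]
  fun_prop

theorem lap_le_of_le (hB : IsGraphBase w m d) {f g : V → ℝ} {x : V}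
    (h : ∀ y, g y - g x ≤ f y - f x) : lap w m g x ≤ lap w m f x := by
  obtain ⟨s, hs⟩ := hB.exists_neighborFinset x
  have hs' := fun y => (hs y).1
  rw [lap_eq_sum hB.2.2.1 _ x s hs', lap_eq_sum hB.2.2.1 f x s hs']
  have := (hB.2.2.2.2.1 x).le
  exact mul_le_mul_of_nonneg_left (Finset.sum_le_sum fun y _ =>
    mul_le_mul_of_nonneg_left (h y) (hB.2.2.1 x y)) (inv_nonneg.2 this)

theorem lap_lt_of_le_of_lt (hB : IsGraphBase w m d) {f g : V → ℝ} {x z : V}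
    (h : ∀ y, g y - g x ≤ f y - f x) (hz : 0 < w x z) (hlt : g z - g x < f z - f x) :
    lap w m g x < lap w m f x := by
  obtain ⟨s, hs⟩ := hB.exists_neighborFinset x
  have hs' := fun y => (hs y).1
  rw [lap_eq_sum hB.2.2.1 _ x s hs', lap_eq_sum hB.2.2.1 f x s hs']
  refine mul_lt_mul_of_pos_left ?_ (inv_pos.2 (hB.2.2.2.2.1 x))
  exact Finset.sum_lt_sum (fun y _ => mul_le_mul_of_nonneg_left (h y) (hB.2.2.1 x y))
    ⟨z, (hs z).1 hz, mul_lt_mul_of_pos_left hlt hz⟩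

theorem lap_le_add_deg (hB : IsGraphBase w m d) {f g : V → ℝ} {x : V} {ε : ℝ}
    (h : ∀ y, g y - g x ≤ f y - f x + ε) : lap w m g x ≤ lap w m f x + ε * deg w m x := by
  obtain ⟨s, hs⟩ := hB.exists_neighborFinset x
  have hs' := fun y => (hs y).1
  have hdeg : deg w m x = (m x)⁻¹ * ∑ y ∈ s, w x y := by
    unfold deg
    congr 1
    apply finsum_eq_sum_of_support_subset
    intro y hy
    exact hs' y (lt_of_le_of_ne (hB.2.2.1 x y) (Ne.symm hy))
  rw [lap_eq_sum hB.2.2.1 _ x s hs', lap_eq_sum hB.2.2.1 f x s hs', hdeg, mul_left_comm,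
    ← mul_add, Finset.mul_sum _ _ ε, ← Finset.sum_add_distrib]
  have := (hB.2.2.2.2.1 x).le
  refine mul_le_mul_of_nonneg_left (Finset.sum_le_sum fun y _ => ?_) (inv_nonneg.2 this)
  nlinarith [mul_le_mul_of_nonneg_left (h y) (hB.2.2.1 x y)]

/-- The strong minimum principle at a vertex. -/
theorem eq_zero_of_lap_nonpos (hB : IsGraphBase w m d) {h : V → ℝ} (h0 : ∀ v, 0 ≤ h v) {x y : V}
    (hx : h x = 0) (hlap : lap w m h x ≤ 0) (hxy : 0 < w x y) : h y = 0 := by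
  by_contra hy
  have hlt : lap w m (fun _ => (0 : ℝ)) x < lap w m h x :=
    lap_lt_of_le_of_lt hB (z := y) (fun v => by simpa [hx] using h0 v) hxy
      (by simpa [hx] using lt_of_le_of_ne (h0 y) (Ne.symm hy))
  have : lap w m (fun _ => (0 : ℝ)) x = 0 := by simp [lap]
  linarith

end Laplacian

section Metric

variable {w : V → V → ℝ} {m : V → ℝ} {d : V → V → ℝ}

theorem IsGraphBase.dist_self (hB : IsGraphBase w m d) (x : V) : d x x = 0 :=
  hB.2.2.2.2.2.2.2.1.1 x

theorem IsGraphBase.dist_pos (hB : IsGraphBase w m d) {x y : V} (h : x ≠ y) : 0 < d x y :=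
  hB.2.2.2.2.2.2.2.1.2.1 x y h

theorem IsGraphBase.dist_comm (hB : IsGraphBase w m d) (x y : V) : d x y = d y x :=
  hB.2.2.2.2.2.2.2.1.2.2.1 x y

theorem IsGraphBase.dist_triangle (hB : IsGraphBase w m d) (x y z : V) :
    d x z ≤ d x y + d y z :=
  hB.2.2.2.2.2.2.2.1.2.2.2.1 x y z

theorem IsGraphBase.dist_nonneg (hB : IsGraphBase w m d) (x y : V) : 0 ≤ d x y := by
  rcases eq_or_ne x y with rfl | h
  · exact (hB.dist_self x).ge
  · exact (hB.dist_pos h).le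

theorem IsGraphBase.ne_of_adj (hB : IsGraphBase w m d) {x y : V} (h : 0 < w x y) : x ≠ y := by
  rintro rfl
  exact h.ne' (hB.2.2.2.1 x)

theorem pathLens_nonempty (hB : IsGraphBase w m d) (x y : V) : (pathLens w d x y).Nonempty := by
  have hxy := hB.2.2.2.2.2.2.1 x y
  induction hxy with
  | refl => exact ⟨0, 0, fun _ => x, rfl, rfl, by simp, by simp⟩
  | @tail b c _ hbc ih =>
    obtain ⟨L, n, p, hp0, hpn, hp, rfl⟩ := ih
    refine ⟨_, n + 1, fun i => if i ≤ n then p i else c, by simp [hp0], by simp, ?_, rfl⟩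
    intro i hi
    rcases Nat.lt_succ_iff_lt_or_eq.1 hi with h | rfl
    · have h1 : i ≤ n := h.le
      have h2 : i + 1 ≤ n := h
      simpa [h1, h2] using hp i h
    · simpa [hpn] using hbc

theorem dist_le_path (hB : IsGraphBase w m d) (p : ℕ → V) (i j : ℕ) (hij : i ≤ j) :
    d (p i) (p j) ≤ ∑ k ∈ Finset.Ico i j, d (p k) (p (k + 1)) := by
  induction j, hij using Nat.le_induction with
  | base => simp [hB.dist_self]
  | succ j hj ih =>
    rw [Finset.sum_Ico_succ_top hj]
    linarith [hB.dist_triangle (p i) (p j) (p (j + 1))]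

theorem dist_add_dist_le_path (hB : IsGraphBase w m d) (p : ℕ → V) {i n : ℕ} (hi : i ≤ n) :
    d (p 0) (p i) + d (p i) (p n) ≤ ∑ k ∈ Finset.range n, d (p k) (p (k + 1)) := by
  rw [Finset.range_eq_Ico, ← Finset.sum_Ico_consecutive _ (Nat.zero_le i) hi]
  exact add_le_add (dist_le_path hB p 0 i (Nat.zero_le i)) (dist_le_path hB p i n hi)

theorem exists_path_lt (hB : IsGraphBase w m d) (x y : V) {ε : ℝ} (hε : 0 < ε) :
    ∃ (n : ℕ) (p : ℕ → V), p 0 = x ∧ p n = y ∧ (∀ i < n, 0 < w (p i) (p (i + 1))) ∧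
      ∀ i ≤ n, d x (p i) + d (p i) y < d x y + ε := by
  have hlt : sInf (pathLens w d x y) < d x y + ε := by
    rw [← hB.2.2.2.2.2.2.2.1.2.2.2.2 x y]
    linarith
  obtain ⟨L, ⟨n, p, hp0, hpn, hp, rfl⟩, hL⟩ :=
    exists_lt_of_csInf_lt (pathLens_nonempty hB x y) hlt
  refine ⟨n, p, hp0, hpn, hp, fun i hi => lt_of_le_of_lt ?_ hL⟩
  simpa [hp0, hpn] using dist_add_dist_le_path hB p hi

/-- Any vertex `x ≠ y` has a neighbor on a geodesic to `y`. -/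
theorem exists_adj_geodesic (hB : IsGraphBase w m d) {x y : V} (hxy : x ≠ y) :
    ∃ z, 0 < w x z ∧ d x z + d z y = d x y := by
  by_contra! hcon
  obtain ⟨s, hs⟩ := hB.exists_neighborFinset x
  have hpos : ∀ z ∈ s, 0 < d x z + d z y - d x y := fun z hz => by
    have h1 := hcon z ((hs z).2 hz)
    have h2 := hB.dist_triangle x z y
    exact sub_pos.2 (lt_of_le_of_ne h2 (Ne.symm h1))
  obtain ⟨ε, hε, hεs⟩ : ∃ ε > 0, ∀ z ∈ s, ε ≤ d x z + d z y - d x y := by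
    rcases s.eq_empty_or_nonempty with rfl | hne
    · exact ⟨1, one_pos, by simp⟩
    · obtain ⟨z, hz, hmin⟩ := s.exists_min_image (fun z => d x z + d z y - d x y) hne
      exact ⟨_, hpos z hz, hmin⟩
  obtain ⟨n, p, hp0, hpn, hp, hlt⟩ := exists_path_lt hB x y hε
  have hn : 0 < n := Nat.pos_of_ne_zero fun h => hxy (by rw [← hp0, ← hpn, h])
  have h1 := hp 0 hn
  rw [hp0] at h1
  linarith [hεs _ ((hs _).1 h1), hlt (0 + 1) hn]

/-- Induction along geodesics towards `y`. -/
theorem geodesic_induction (hB : IsGraphBase w m d) (y : V) {P : V → Prop} (h0 : P y)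
    (hstep : ∀ x z, x ≠ y → 0 < w x z → d x z + d z y = d x y → P z → P x) (x : V) : P x := by
  have hfin : ∀ x, {z | d z y < d x y}.Finite := fun x =>
    (hB.2.2.2.2.2.2.2.2 y (d x y)).subset fun z (hz : d z y < d x y) => by
      simpa [hB.dist_comm y z] using hz.le
  induction hn : {z | d z y < d x y}.ncard using Nat.strong_induction_on generalizing x with
  | _ n ih =>
    rcases eq_or_ne x y with rfl | hxy
    · exact h0
    obtain ⟨z, hz, hd⟩ := exists_adj_geodesic hB hxy
    have hlt : d z y < d x y := by linarith [hB.dist_pos (hB.ne_of_adj hz)]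
    refine hstep x z hxy hz hd (ih _ ?_ z rfl)
    rw [← hn]
    refine Set.ncard_lt_ncard ⟨fun v (hv : d v y < d z y) => hv.trans hlt, fun h => ?_⟩ (hfin x)
    have hzz : d z y < d z y := h hlt
    exact hzz.false

theorem cutConnected_of_closedBall (hB : IsGraphBase w m d) (o : V) (R : ℝ) (K : Finset V)
    (hK : ∀ v, v ∈ K ↔ d v o ≤ R) : CutConnected w K := by
  intro A hA hne
  obtain ⟨k, hkK, hkA⟩ := Finset.exists_of_ssubset hA
  by_contra! hcon
  have hiff : ∀ x, x ∈ K → (x ∈ A ↔ o ∈ A) := by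
    refine geodesic_induction hB o (fun _ => Iff.rfl) fun x z _ hz hd ih hx => ?_
    have hzK : z ∈ K := by
      rw [hK] at hx ⊢
      linarith [hB.dist_nonneg x z]
    rw [← ih hzK]
    constructor
    · intro hxA
      by_contra hzA
      exact (hcon x hxA z hzK hzA).not_gt hz
    · intro hzA
      by_contra hxA
      exact (hcon z hzA x hx hxA).not_gt (hB.2.1 x z ▸ hz)
  obtain ⟨a, ha⟩ := hne
  exact hkA ((hiff k hkK).2 ((hiff a (hA.1 ha)).1 ha))

end Metric

section Curvature

variable {w : V → V → ℝ} {m : V → ℝ} {d : V → V → ℝ}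

theorem lap_le_lap_of_adj (hB : IsGraphBase w m d) (hK : NonnegCurv w m d) {f : V → ℝ}
    (hf : Lip1 d f) {x y : V} (hxy : 0 < w x y) (h : f y - f x = d x y) :
    lap w m f y ≤ lap w m f x := by
  have hk := hK x y hxy
  unfold kappa at hk
  have hd := inv_pos.2 (hB.dist_pos (hB.ne_of_adj hxy))
  have h0 := nonneg_of_mul_nonneg_right hk hd
  refine sub_nonneg.1 (h0.trans (csInf_le ?_ ⟨f, hf, h, rfl⟩))
  refine ⟨lap w m (fun v => - d v x) x - lap w m (fun v => d v y) y, ?_⟩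
  rintro c ⟨g, hg, -, rfl⟩
  refine sub_le_sub (lap_le_of_le hB fun v => ?_) (lap_le_of_le hB fun v => ?_)
  · linarith [hg v x, hB.dist_self x]
  · linarith [hg y v, hB.dist_self y, hB.dist_comm y v]

/-- Nonnegative curvature on edges propagates to arbitrary pairs of vertices. -/
theorem lap_le_lap (hB : IsGraphBase w m d) (hK : NonnegCurv w m d) {f : V → ℝ}
    (hf : Lip1 d f) {x y : V} (h : f y - f x = d x y) : lap w m f y ≤ lap w m f x := by
  revert h
  refine geodesic_induction hB y (P := fun x => f y - f x = d x y → lap w m f y ≤ lap w m f x)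
    (fun _ => le_rfl) (fun x z _ hz hd ih h => ?_) x
  have h1 := hf x z
  have h2 := hf z y
  exact (ih (by linarith)).trans (lap_le_lap_of_adj hB hK hf hz (by linarith))

end Curvature

section Extremal

variable {w : V → V → ℝ} {m : V → ℝ} {d : V → V → ℝ} {X : Set V} {K : Finset V}

theorem exists_separating_vertex (hB : IsGraphBase w m d) (hX : Separates w X K) {x y : V}
    (hx : x ∈ X) (hy : y ∉ X) {ε : ℝ} (hε : 0 < ε) :
    ∃ k ∈ K, d x k + d k y < d x y + ε := by
  obtain ⟨n, p, hp0, hpn, hp, hlt⟩ := exists_path_lt hB x y hε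
  by_contra! hcon
  have hmem : ∀ i ≤ n, p i ∈ X := by
    intro i
    induction i with
    | zero => exact fun _ => hp0 ▸ hx
    | succ i ih =>
      intro hi
      by_contra hout
      rcases hX _ (ih (Nat.le_of_succ_le hi)) _ hout (hp i hi) with h | h
      · exact (hcon _ h).not_gt (hlt i (Nat.le_of_succ_le hi))
      · exact (hcon _ h).not_gt (hlt _ hi)
  exact hy (hpn ▸ hmem n le_rfl)

/-- Extremal Lipschitz extension of a Lipschitz function on `K`. -/
theorem exists_isExtremal (hB : IsGraphBase w m d) (hX : Separates w X K) (hne : K.Nonempty)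
    {φ : V → ℝ} (hφ : ∀ x ∈ K, ∀ y ∈ K, φ y - φ x ≤ d x y) :
    ∃ g, IsExtremal d X K g ∧ ∀ k ∈ K, g k = φ k := by
  have hlow : ∀ v, ∃ u ∈ K, ∀ k ∈ K, φ k - d v k ≤ φ u - d v u := fun v =>
    K.exists_max_image (fun k => φ k - d v k) hne
  have hupp : ∀ v, ∃ u ∈ K, ∀ k ∈ K, φ u + d v u ≤ φ k + d v k := fun v =>
    K.exists_min_image (fun k => φ k + d v k) hne
  choose a haK ha using hlow
  choose b hbK hb using hupp
  classical
  let g : V → ℝ := fun v => if v ∈ X then φ (a v) - d v (a v) else φ (b v) + d v (b v)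
  have hgX : ∀ v ∈ X, g v = φ (a v) - d v (a v) := fun v hv => if_pos hv
  have hgX' : ∀ v ∉ X, g v = φ (b v) + d v (b v) := fun v hv => if_neg hv
  have hgK : ∀ k ∈ K, g k = φ k := by
    intro k hk
    by_cases hkX : k ∈ X
    · rw [hgX k hkX]
      have h1 := ha k k hk
      have h2 := hφ k hk _ (haK k)
      linarith [hB.dist_self k]
    · rw [hgX' k hkX]
      have h1 := hb k k hk
      have h2 := hφ _ (hbK k) k hk
      linarith [hB.dist_self k, hB.dist_comm k (b k)]
  refine ⟨g, ⟨fun x y => ?_, fun x hx => ⟨a x, haK x, ?_⟩, fun x hx => ⟨b x, hbK x, ?_⟩⟩, hgK⟩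
  · by_cases hx : x ∈ X <;> by_cases hy : y ∈ X
    · rw [hgX x hx, hgX y hy]
      linarith [ha x _ (haK y), hB.dist_triangle x y (a y)]
    · rw [hgX x hx, hgX' y hy]
      refine le_of_forall_pos_le_add fun ε hε => ?_
      obtain ⟨k, hk, hlt⟩ := exists_separating_vertex hB hX hx hy hε
      linarith [ha x k hk, hb y k hk, hB.dist_comm k y]
    · rw [hgX' x hx, hgX y hy]
      linarith [hφ _ (hbK x) _ (haK y), hB.dist_triangle (b x) x (a y),
        hB.dist_triangle x y (a y), hB.dist_comm x (b x)]
    · rw [hgX' x hx, hgX' y hy]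
      linarith [hb y _ (hbK x), hB.dist_triangle y x (b x), hB.dist_comm x y]
  · rw [hgK _ (haK x), hgX x hx]
    ring
  · rw [hgK _ (hbK x), hgX' x hx]
    ring

theorem IsExtremal.le_of_le {f g : V → ℝ} (hf : IsExtremal d X K f) (hg : IsExtremal d X K g)
    (hB : IsGraphBase w m d) {c : ℝ} (h : ∀ k ∈ K, f k ≤ g k + c) (v : V) : f v ≤ g v + c := by
  by_cases hv : v ∈ X
  · obtain ⟨u, hu, hfu⟩ := hf.2.1 v hv
    linarith [h u hu, hg.1 v u]
  · obtain ⟨u, hu, hgu⟩ := hg.2.2 v hv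
    linarith [h u hu, hf.1 u v, hB.dist_comm u v]

/-- Raising an extremal function on the set where its Laplacian is maximal decreases the
Laplacian at some of these vertices without creating new maximal ones. -/
theorem exists_raise (hB : IsGraphBase w m d) (hC : NonnegCurv w m d) (hX : Separates w X K)
    (hcut : CutConnected w K) {f : V → ℝ} (hf : IsExtremal d X K f) {c : ℝ}
    (hle : ∀ k ∈ K, lap w m f k ≤ c) (hlt : ∃ k ∈ K, lap w m f k < c)
    (heq : ∃ k ∈ K, lap w m f k = c) :
    ∃ g, IsExtremal d X K g ∧ (∀ k ∈ K, lap w m g k ≤ c) ∧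
      (∀ k ∈ K, lap w m f k < c → lap w m g k < c) ∧
      ∃ k ∈ K, lap w m f k = c ∧ lap w m g k < c := by
  classical
  obtain ⟨k₀, hk₀, hk₀lt⟩ := hlt
  obtain ⟨a₀, ha₀, ha₀eq⟩ := heq
  let A := K.filter fun k => lap w m f k = c
  have hA : ∀ k, k ∈ A ↔ k ∈ K ∧ lap w m f k = c := fun k => Finset.mem_filter
  have hslack : ∀ a ∈ A, ∀ k ∈ K, k ∉ A → 0 < d k a - (f a - f k) := by
    intro a ha k hk hkA
    refine sub_pos.2 (lt_of_le_of_ne (hf.1 k a) fun h => hkA ?_)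
    have := lap_le_lap hB hC hf.1 h
    exact (hA k).2 ⟨hk, le_antisymm (hle k hk) (((hA a).1 ha).2 ▸ this)⟩
  have hev : ∀ᶠ ε in nhdsWithin (0 : ℝ) (Set.Ioi 0),
      (∀ a ∈ A, ∀ k ∈ K, k ∉ A → ε ≤ d k a - (f a - f k)) ∧
      ∀ k ∈ K, lap w m f k < c → lap w m f k + ε * deg w m k < c := by
    apply Filter.Eventually.filter_mono nhdsWithin_le_nhds
    refine ((Finset.eventually_all A).2 fun a ha => (Finset.eventually_all K).2 fun k hk =>
      eventually_imp_distrib_left.2 fun hkA => ?_).and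
      ((Finset.eventually_all K).2 fun k hk => eventually_imp_distrib_left.2 fun hkc => ?_)
    · exact (eventually_lt_nhds (hslack a ha k hk hkA)).mono fun _ => le_of_lt
    · have ht : Tendsto (fun ε : ℝ => lap w m f k + ε * deg w m k) (nhds 0)
          (nhds (lap w m f k + 0 * deg w m k)) :=
        Continuous.tendsto (by fun_prop) 0
      exact ht.eventually_lt_const (by simpa using hkc)
  obtain ⟨ε, ⟨hε1, hε2⟩, hε⟩ := (hev.and self_mem_nhdsWithin).exists
  have hε : 0 < ε := hε
  obtain ⟨g, hg, hgK⟩ := exists_isExtremal hB hX ⟨k₀, hk₀⟩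
    (φ := fun v => if v ∈ A then f v + ε else f v) (by
      intro x hx y hy
      have h1 := hf.1 x y
      by_cases hxA : x ∈ A <;> by_cases hyA : y ∈ A
      · simp only [hxA, hyA, if_true]; linarith
      · simp only [hxA, hyA, if_true, if_false]; linarith
      · simp only [hxA, hyA, if_true, if_false]; linarith [hε1 y hyA x hx hxA]
      · simpa only [hxA, hyA, if_false] using h1)
  have hgA : ∀ a ∈ A, g a = f a + ε := fun a ha => by
    rw [hgK a ((hA a).1 ha).1, if_pos ha]
  have hgA' : ∀ k ∈ K, k ∉ A → g k = f k := fun k hk hkA => by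
    rw [hgK k hk, if_neg hkA]
  have hgle : ∀ v, g v ≤ f v + ε := hg.le_of_le hf hB fun k hk => by
    by_cases hkA : k ∈ A
    · exact (hgA k hkA).le
    · rw [hgA' k hk hkA]; linarith
  have hleA : ∀ a ∈ A, lap w m g a ≤ lap w m f a := fun a ha =>
    lap_le_of_le hB fun v => by linarith [hgA a ha, hgle v]
  have hltA : ∀ k ∈ K, lap w m f k < c → lap w m g k < c := fun k hk hkc => by
    have hkA : k ∉ A := fun h => hkc.ne ((hA k).1 h).2
    refine lt_of_le_of_lt (lap_le_add_deg hB fun v => ?_) (hε2 k hk hkc)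
    linarith [hgA' k hk hkA, hgle v]
  refine ⟨g, hg, fun k hk => ?_, hltA, ?_⟩
  · rcases (hle k hk).lt_or_eq with h | h
    · exact (hltA k hk h).le
    · exact (hleA k ((hA k).2 ⟨hk, h⟩)).trans h.le
  · obtain ⟨a, ha, k, hk, hkA, hak⟩ := hcut A
      ⟨Finset.filter_subset _ _, fun h => hk₀lt.ne ((hA k₀).1 (h hk₀)).2⟩
      ⟨a₀, (hA a₀).2 ⟨ha₀, ha₀eq⟩⟩
    refine ⟨a, ((hA a).1 ha).1, ((hA a).1 ha).2, ?_⟩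
    rw [← ((hA a).1 ha).2]
    refine lap_lt_of_le_of_lt hB (z := k) (fun v => ?_) hak ?_
    · linarith [hgA a ha, hgle v]
    · linarith [hgA a ha, hgA' k hk hkA]

theorem exists_lap_lt (hB : IsGraphBase w m d) (hC : NonnegCurv w m d) (hX : Separates w X K)
    (hcut : CutConnected w K) {f : V → ℝ} (hf : IsExtremal d X K f) {c : ℝ}
    (hle : ∀ k ∈ K, lap w m f k ≤ c) (hlt : ∃ k ∈ K, lap w m f k < c) :
    ∃ g, IsExtremal d X K g ∧ ∀ k ∈ K, lap w m g k < c := by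
  classical
  induction hn : (K.filter fun k => lap w m f k = c).card using Nat.strong_induction_on
    generalizing f with
  | _ n ih =>
    by_cases heq : ∃ k ∈ K, lap w m f k = c
    · obtain ⟨g, hg, hgle, hglt, k, hk, hfk, hgk⟩ := exists_raise hB hC hX hcut hf hle hlt heq
      refine ih _ ?_ hg hgle (hlt.imp fun k hk => ⟨hk.1, hglt k hk.1 hk.2⟩) rfl
      rw [← hn]
      apply Finset.card_lt_card
      refine ⟨fun v hv => ?_, fun h => ?_⟩
      · rw [Finset.mem_filter] at hv ⊢
        refine ⟨hv.1, (hle v hv.1).antisymm (not_lt.1 fun h => ?_)⟩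
        exact (hglt v hv.1 h).ne hv.2
      · exact hgk.ne (Finset.mem_filter.1 (h (Finset.mem_filter.2 ⟨hk, hfk⟩))).2
    · push Not at heq
      exact ⟨f, hf, fun k hk => lt_of_le_of_ne (hle k hk) (heq k hk)⟩

theorem IsExtremal.sub_const {f : V → ℝ} (hf : IsExtremal d X K f) (c : ℝ) :
    IsExtremal d X K fun v => f v - c :=
  ⟨fun x y => by simpa using hf.1 x y, by simpa using hf.2.1, by simpa using hf.2.2⟩

theorem isCompact_isExtremal (hB : IsGraphBase w m d) (o : V) :
    IsCompact {f : V → ℝ | f o = 0 ∧ IsExtremal d X K f} := by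
  have hcpt : IsCompact (Set.pi Set.univ fun v : V => Set.Icc (-d o v) (d o v)) :=
    isCompact_univ_pi fun v => isCompact_Icc
  refine hcpt.of_isClosed_subset ?_ ?_
  · have hev : ∀ x y : V, Continuous fun f : V → ℝ => f x - f y := fun x y => by fun_prop
    refine IsClosed.and (isClosed_eq (by fun_prop) (by fun_prop))
      (IsClosed.and ?_ (IsClosed.and ?_ ?_))
    · simp only [Lip1, Set.ofPred_forall]
      exact isClosed_iInter fun x => isClosed_iInter fun y =>
        isClosed_le (hev y x) continuous_const
    · simp only [Set.ofPred_forall]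
      refine isClosed_iInter fun x => isClosed_iInter fun _ => ?_
      have : {f : V → ℝ | ∃ u ∈ K, f u - f x = d x u} =
          ⋃ u ∈ K, {f : V → ℝ | f u - f x = d x u} := by ext; simp
      rw [this]
      exact isClosed_biUnion_finset fun u _ => isClosed_eq (hev u x) continuous_const
    · simp only [Set.ofPred_forall]
      refine isClosed_iInter fun x => isClosed_iInter fun _ => ?_
      have : {f : V → ℝ | ∃ u ∈ K, f x - f u = d x u} =
          ⋃ u ∈ K, {f : V → ℝ | f x - f u = d x u} := by ext; simp
      rw [this]
      exact isClosed_biUnion_finset fun u _ => isClosed_eq (hev x u) continuous_const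
  · rintro f ⟨hfo, hf⟩ v -
    have h1 := hf.1 o v
    have h2 := hf.1 v o
    rw [hfo] at h1 h2
    rw [hB.dist_comm v o] at h2
    constructor <;> linarith

/-- The variational principle: some extremal function has constant Laplacian on `K`. -/
theorem exists_lap_eq_const (hB : IsGraphBase w m d) (hC : NonnegCurv w m d)
    (hX : Separates w X K) (hcut : CutConnected w K) (hne : K.Nonempty) :
    ∃ f c, IsExtremal d X K f ∧ ∀ k ∈ K, lap w m f k = c := by
  have ⟨o, _⟩ := hne
  obtain ⟨g, hg, -⟩ := exists_isExtremal hB hX hne (φ := fun _ => 0)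
    fun x _ y _ => by simpa using hB.dist_nonneg x y
  have hcont : Continuous fun f : V → ℝ => K.sup' hne fun k => lap w m f k :=
    Continuous.finset_sup'_apply hne fun k _ => continuous_lap hB k
  obtain ⟨f, ⟨hfo, hf⟩, hmin⟩ := (isCompact_isExtremal hB o).exists_isMinOn
    ⟨_, by simp, hg.sub_const (g o)⟩ hcont.continuousOn
  refine ⟨f, K.sup' hne fun k => lap w m f k, hf, ?_⟩
  by_contra! hcon
  obtain ⟨k, hk, hkne⟩ := hcon
  have hle : ∀ k ∈ K, lap w m f k ≤ K.sup' hne fun k => lap w m f k := fun k hk =>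
    Finset.le_sup' (fun k => lap w m f k) hk
  obtain ⟨g', hg', hlt⟩ := exists_lap_lt hB hC hX hcut hf hle
    ⟨k, hk, lt_of_le_of_ne (hle k hk) hkne⟩
  have h := isMinOn_iff.1 hmin _ ⟨sub_self _, hg'.sub_const (g' o)⟩
  simp only [lap_sub_const] at h
  exact h.not_gt ((Finset.sup'_lt_iff hne).2 hlt)

end Extremal

section Volume

variable {w : V → V → ℝ} {m : V → ℝ} {d : V → V → ℝ} {X : Set V} {K : Finset V}

theorem IsExtremal.finite_superlevel {f : V → ℝ} (hf : IsExtremal d X K f)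
    (hB : IsGraphBase w m d) (r : ℝ) : {x | x ∈ X ∧ r ≤ f x}.Finite := by
  refine (K.finite_toSet.biUnion fun u _ => hB.2.2.2.2.2.2.2.2 u (f u - r)).subset ?_
  rintro x ⟨hx, hr⟩
  obtain ⟨u, hu, h⟩ := hf.2.1 x hx
  refine Set.mem_biUnion hu ?_
  change d u x ≤ f u - r
  linarith [hB.dist_comm u x]

/-- The total Laplacian over a finite set only sees the edges leaving the set. -/
theorem sum_mul_lap_le (hB : IsGraphBase w m d) {f : V → ℝ} {A : Finset V}
    {D : V → V → ℝ} (hD0 : ∀ x y, 0 ≤ D x y)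
    (hD : ∀ x ∈ A, ∀ y ∉ A, y ∈ K → w x y * (f y - f x) ≤ D y x)
    (hD' : ∀ x ∈ A, ∀ y ∉ A, y ∉ K → w x y * (f y - f x) ≤ 0) :
    ∑ x ∈ A, m x * lap w m f x ≤ ∑ k ∈ K, ∑ x ∈ A, D k x := by
  classical
  choose N hN using hB.exists_neighborFinset
  let B := (A ∪ K) ∪ A.biUnion N
  have hAB : A ⊆ B := fun x hx => by simp [B, hx]
  have hKB : K ⊆ B := fun x hx => by simp [B, hx]
  have h1 : ∀ x ∈ A, m x * lap w m f x = ∑ y ∈ B, w x y * (f y - f x) := by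
    intro x hx
    rw [lap_eq_sum hB.2.2.1 f x B fun y hy => ?_,
      mul_inv_cancel_left₀ (hB.2.2.2.2.1 x).ne']
    exact Finset.mem_union_right _ (Finset.mem_biUnion.2 ⟨x, hx, (hN x y).1 hy⟩)
  have h2 : ∑ x ∈ A, ∑ y ∈ A, w x y * (f y - f x) = 0 := by
    have hanti : ∑ x ∈ A, ∑ y ∈ A, w x y * (f y - f x) =
        -∑ x ∈ A, ∑ y ∈ A, w x y * (f y - f x) := by
      conv_lhs => rw [Finset.sum_comm]
      simp_rw [← Finset.sum_neg_distrib]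
      refine Finset.sum_congr rfl fun y _ => Finset.sum_congr rfl fun x _ => ?_
      rw [hB.2.1 x y]
      ring
    linarith
  rw [Finset.sum_congr rfl h1, Finset.sum_comm (s := K)]
  simp_rw [← Finset.sum_sdiff hAB]
  rw [Finset.sum_add_distrib, h2, add_zero]
  refine Finset.sum_le_sum fun x hx => ?_
  calc ∑ y ∈ B \ A, w x y * (f y - f x)
      ≤ ∑ y ∈ B \ A, if y ∈ K then D y x else 0 := by
        refine Finset.sum_le_sum fun y hy => ?_
        have hyA := (Finset.mem_sdiff.1 hy).2
        split_ifs with hyK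
        · exact hD x hx y hyA hyK
        · exact hD' x hx y hyA hyK
    _ ≤ ∑ y ∈ B, if y ∈ K then D y x else 0 := by
        refine Finset.sum_le_sum_of_subset_of_nonneg Finset.sdiff_subset fun y _ _ => ?_
        split_ifs
        exacts [hD0 y x, le_rfl]
    _ = ∑ y ∈ K, D y x := by
        rw [← Finset.sum_filter, Finset.filter_mem_eq_inter, Finset.inter_eq_right.2 hKB]

/-- If `X` is infinite and the measure is bounded below, no extremal function has
Laplacian bounded below by a positive constant on `K`. -/
theorem lap_const_nonpos (hB : IsGraphBase w m d) (hC : NonnegCurv w m d)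
    (hm : ∃ c : ℝ, 0 < c ∧ ∀ x, c ≤ m x) (hX : Separates w X K) (hinf : X.Infinite)
    {f : V → ℝ} (hf : IsExtremal d X K f) {c : ℝ} (hc : ∀ k ∈ K, c ≤ lap w m f k) : c ≤ 0 := by
  classical
  by_contra! hpos
  obtain ⟨δ, hδ, hδm⟩ := hm
  choose N hN using hB.exists_neighborFinset
  have hlapX : ∀ x ∈ X, c ≤ lap w m f x := fun x hx => by
    obtain ⟨u, hu, h⟩ := hf.2.1 x hx
    exact (hc u hu).trans (lap_le_lap hB hC hf.1 h)
  let D := ∑ k ∈ K, ∑ x ∈ N k, w k x * d k x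
  obtain ⟨n, hn⟩ := exists_nat_gt (D / (c * δ))
  have hinf' : (X \ K).Infinite := hinf.sdiff K.finite_toSet
  obtain ⟨F, hFX, hFn⟩ := hinf'.exists_subset_card_eq n
  obtain ⟨r, hr⟩ : ∃ r, ∀ x ∈ F, r ≤ f x := by
    obtain ⟨r, hr⟩ := (F.image f).bddBelow
    exact ⟨r, fun x hx => hr (by simpa using ⟨x, hx, rfl⟩)⟩
  have hfin : {x | (x ∈ X ∧ r ≤ f x) ∧ x ∉ K}.Finite :=
    (hf.finite_superlevel hB r).subset fun x hx => hx.1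
  let A := hfin.toFinset
  have hA : ∀ x, x ∈ A ↔ (x ∈ X ∧ r ≤ f x) ∧ x ∉ K := fun x => hfin.mem_toFinset
  have hFA : F ⊆ A := fun x hx => (hA x).2 ⟨⟨(hFX hx).1, hr x hx⟩, (hFX hx).2⟩
  have hD0 : ∀ x y, 0 ≤ w x y * d x y := fun x y =>
    mul_nonneg (hB.2.2.1 x y) (hB.dist_nonneg x y)
  have hupper : ∑ x ∈ A, m x * lap w m f x ≤ ∑ k ∈ K, ∑ x ∈ A, w k x * d k x := by
    refine sum_mul_lap_le hB hD0 (fun x _ y _ _ => ?_) fun x hx y hyA hyK => ?_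
    · rw [hB.2.1 y x, hB.dist_comm y x]
      exact mul_le_mul_of_nonneg_left (hf.1 x y) (hB.2.2.1 x y)
    · obtain ⟨⟨hxX, hxr⟩, hxK⟩ := (hA x).1 hx
      rcases (hB.2.2.1 x y).eq_or_lt with h0 | hxy
      · simp [← h0]
      have hyX : y ∈ X := by
        by_contra hyX
        rcases hX x hxX y hyX hxy with h | h
        exacts [hxK h, hyK h]
      have hyr : f y < r := by
        by_contra! hyr
        exact hyA ((hA y).2 ⟨⟨hyX, hyr⟩, hyK⟩)
      exact mul_nonpos_of_nonneg_of_nonpos hxy.le (by linarith)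
  have hupper' : ∑ k ∈ K, ∑ x ∈ A, w k x * d k x ≤ D := by
    refine Finset.sum_le_sum fun k _ => ?_
    rw [← Finset.sum_filter_add_sum_filter_not A (fun x => x ∈ N k)]
    have hz : ∑ x ∈ A with x ∉ N k, w k x * d k x = 0 := by
      refine Finset.sum_eq_zero fun x hx => ?_
      have : ¬ 0 < w k x := fun h => (Finset.mem_filter.1 hx).2 ((hN k x).1 h)
      rw [le_antisymm (not_lt.1 this) (hB.2.2.1 k x), zero_mul]
    rw [hz, add_zero]
    refine Finset.sum_le_sum_of_subset_of_nonneg (fun x hx => (Finset.mem_filter.1 hx).2)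
      fun x _ _ => hD0 k x
  have hlower : (n : ℝ) * (c * δ) ≤ ∑ x ∈ A, m x * lap w m f x := by
    have hterm : ∀ x ∈ A, c * δ ≤ m x * lap w m f x := fun x hx => by
      have := hlapX x ((hA x).1 hx).1.1
      rw [mul_comm c]
      exact mul_le_mul (hδm x) this hpos.le (hδ.le.trans (hδm x))
    calc (n : ℝ) * (c * δ) = ∑ x ∈ F, c * δ := by rw [Finset.sum_const, hFn, nsmul_eq_mul]
      _ ≤ ∑ x ∈ A, c * δ :=
        Finset.sum_le_sum_of_subset_of_nonneg hFA fun _ _ _ => (mul_pos hpos hδ).le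
      _ ≤ _ := Finset.sum_le_sum hterm
  rw [div_lt_iff₀ (mul_pos hpos hδ)] at hn
  linarith

/-- An extremal function which is superharmonic outside of `X ∖ K`. -/
theorem exists_isExtremal_superharmonic (hB : IsGraphBase w m d) (hC : NonnegCurv w m d)
    (hm : ∃ c : ℝ, 0 < c ∧ ∀ x, c ≤ m x) (hX : Separates w X K) (hinf : X.Infinite)
    (hcut : CutConnected w K) (hne : K.Nonempty) :
    ∃ f, IsExtremal d X K f ∧ ∀ x, x ∈ K ∨ x ∉ X → lap w m f x ≤ 0 := by
  obtain ⟨f, c, hf, hc⟩ := exists_lap_eq_const hB hC hX hcut hne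
  have hc0 := lap_const_nonpos hB hC hm hX hinf hf fun k hk => (hc k hk).ge
  refine ⟨f, hf, ?_⟩
  rintro x (hx | hx)
  · exact (hc x hx).trans_le hc0
  · obtain ⟨u, hu, h⟩ := hf.2.2 x hx
    rw [hB.dist_comm] at h
    exact (lap_le_lap hB hC hf.1 h).trans ((hc u hu).trans_le hc0)

end Volume

section Ends

variable {w : V → V → ℝ} {m : V → ℝ} {d : V → V → ℝ} {K : Finset V}

/-- Two infinite disjoint parts separated by `K` leave no room for a third one. -/
theorem finite_of_disjoint_separates (hB : IsGraphBase w m d) (hC : NonnegCurv w m d)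
    (hm : ∃ c : ℝ, 0 < c ∧ ∀ x, c ≤ m x) {X Y Z : Set V} {o : V} {R : ℝ}
    (hK : ∀ v, v ∈ K ↔ d v o ≤ R) (hne : K.Nonempty)
    (hX : Separates w X K) (hY : Separates w Y K) (hZ : Separates w Z K)
    (hXinf : X.Infinite) (hYinf : Y.Infinite)
    (hXY : Disjoint X Y) (hXZ : Disjoint X Z) (hYZ : Disjoint Y Z) : Z.Finite := by
  classical
  have hcut := cutConnected_of_closedBall hB o R K hK
  obtain ⟨f, hf, hfΔ⟩ := exists_isExtremal_superharmonic hB hC hm hX hXinf hcut hne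
  obtain ⟨g₀, hg₀, hgΔ₀⟩ := exists_isExtremal_superharmonic hB hC hm hY hYinf hcut hne
  obtain ⟨k₀, hk₀, hmin⟩ := K.exists_min_image (fun k => f k + g₀ k) hne
  obtain ⟨g, hg, hgΔ, hk0, hpos⟩ : ∃ g, IsExtremal d Y K g ∧
      (∀ x, x ∈ K ∨ x ∉ Y → lap w m g x ≤ 0) ∧ f k₀ + g k₀ = 0 ∧ ∀ k ∈ K, 0 ≤ f k + g k :=
    ⟨_, hg₀.sub_const (f k₀ + g₀ k₀), by simpa only [lap_sub_const] using hgΔ₀, by ring,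
      fun k hk => by linarith [hmin k hk]⟩
  have hnonneg : ∀ v, 0 ≤ f v + g v := by
    intro v
    by_cases hv : v ∈ X
    · obtain ⟨u, hu, h⟩ := hg.2.2 v (Set.disjoint_left.1 hXY hv)
      linarith [hf.1 v u, hpos u hu]
    · obtain ⟨u, hu, h⟩ := hf.2.2 v hv
      linarith [hg.1 v u, hpos u hu]
  have hstep : ∀ x y, x ∈ K ∨ x ∈ Z → f x + g x = 0 → 0 < w x y → f y + g y = 0 := by
    intro x y hx h0 hxy
    refine eq_zero_of_lap_nonpos hB (h := fun v => f v + g v) hnonneg h0 ?_ hxy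
    rw [lap_add hB]
    exact add_nonpos (hfΔ x (hx.imp_right fun h => Set.disjoint_right.1 hXZ h))
      (hgΔ x (hx.imp_right fun h => Set.disjoint_right.1 hYZ h))
  have hzeroK : ∀ k ∈ K, f k + g k = 0 := by
    by_contra! hcon
    obtain ⟨k, hk, hkne⟩ := hcon
    obtain ⟨a, ha, b, hb, hbA, hab⟩ := hcut (K.filter fun v => f v + g v = 0)
      ⟨Finset.filter_subset _ _, fun h => hkne (Finset.mem_filter.1 (h hk)).2⟩
      ⟨k₀, Finset.mem_filter.2 ⟨hk₀, hk0⟩⟩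
    rw [Finset.mem_filter] at ha
    exact hbA (Finset.mem_filter.2 ⟨hb, hstep a b (Or.inl ha.1) ha.2 hab⟩)
  have hR : 0 ≤ R := (hB.dist_nonneg k₀ o).trans ((hK k₀).1 hk₀)
  have hzero : ∀ v, v ∈ K ∨ v ∈ Z → f v + g v = 0 := by
    have hoK : o ∈ K := (hK o).2 (by rw [hB.dist_self]; exact hR)
    refine geodesic_induction hB o (fun _ => hzeroK o hoK) fun x z _ hz _ ih hx => ?_
    by_cases hxK : x ∈ K
    · exact hzeroK x hxK
    have hxZ := hx.resolve_left hxK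
    have hzZ : z ∈ K ∨ z ∈ Z := by
      by_contra! hcon
      rcases hZ x hxZ z hcon.2 hz with h | h
      exacts [hxK h, hcon.1 h]
    exact hstep z x hzZ (ih hzZ) (hB.2.1 x z ▸ hz)
  refine (hB.2.2.2.2.2.2.2.2 o (3 * R)).subset fun v hv => ?_
  obtain ⟨u, hu, hfu⟩ := hf.2.2 v (Set.disjoint_right.1 hXZ hv)
  obtain ⟨u', hu', hgu⟩ := hg.2.2 v (Set.disjoint_right.1 hYZ hv)
  change d o v ≤ 3 * R
  have h1 := hzero v (Or.inr hv)
  have h2 := hzeroK u' hu'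
  have h3 := hf.1 u u'
  linarith [(hK u).1 hu, (hK u').1 hu', hB.dist_triangle u o u', hB.dist_triangle v u o,
    hB.dist_comm o v, hB.dist_comm o u', hB.dist_nonneg v u']

theorem reachIn_symm (hB : IsGraphBase w m d) {A : Set V} {x y : V} (h : reachIn w A x y) :
    reachIn w A y x := by
  induction h with
  | refl => exact Relation.ReflTransGen.refl
  | tail _ h ih => exact Relation.ReflTransGen.head ⟨h.2.1, h.1, hB.2.1 _ _ ▸ h.2.2⟩ ih

end Ends

/-- **Corollary.** A connected, locally finite weighted graph with non-negative
Ollivier curvature and `inf_x m(x) > 0` has at most two ends. -/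
theorem at_most_two_ends_of_inf_measure_pos {V : Type*} (w : V → V → ℝ)
    (m : V → ℝ) (d : V → V → ℝ)
    (hB : IsGraphBase w m d) (hK : NonnegCurv w m d)
    (hm : ∃ c : ℝ, 0 < c ∧ ∀ x, c ≤ m x) :
    ¬ atLeastEnds w 3 := by
  rintro ⟨K₀, hfin, x, -, hinf, hdis⟩
  let o := x 0
  obtain ⟨R, hR0, hR⟩ : ∃ R, 0 ≤ R ∧ ∀ v ∈ K₀, d v o ≤ R := by
    obtain ⟨R, hR⟩ := (hfin.image fun v => d v o).bddAbove
    exact ⟨max R 0, le_max_right _ _, fun v hv => (hR ⟨v, hv, rfl⟩).trans (le_max_left _ _)⟩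
  let K := (hB.2.2.2.2.2.2.2.2 o R).toFinset
  have hmem : ∀ v, v ∈ K ↔ d v o ≤ R := fun v => by simp [K, hB.dist_comm v o]
  have hsep : ∀ i, Separates w {y | reachIn w K₀ᶜ (x i) y} K := by
    intro i a ha b hb hab
    by_contra! hcon
    refine hb (Relation.ReflTransGen.tail ha ⟨fun h => hcon.1 ?_, fun h => hcon.2 ?_, hab⟩)
    · exact (hmem a).2 (hR a h)
    · exact (hmem b).2 (hR b h)
  have hdisj : ∀ i j, i ≠ j →
      Disjoint {y | reachIn w K₀ᶜ (x i) y} {y | reachIn w K₀ᶜ (x j) y} := fun i j hij =>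
    Set.disjoint_left.2 fun y hi hj =>
      hdis i j hij (Relation.ReflTransGen.trans hi (reachIn_symm hB hj))
  exact hinf 2 (finite_of_disjoint_separates hB hK hm hmem
    ⟨o, (hmem o).2 (by rw [hB.dist_self]; exact hR0)⟩ (hsep 0) (hsep 1) (hsep 2)
    (hinf 0) (hinf 1) (hdisj 0 1 (by decide)) (hdisj 0 2 (by decide)) (hdisj 1 2 (by decide)))

end SalamiPaper
end

section
/- Let G=(V,w,m,d₀) be a salami with the combinatorial distance d₀. Suppose there is ε > 0 such that w(x,y) ≥ ε for all adjacent x,y. Then the real vector space of all harmonic functions on G has finite dimension, bounded above by (2/ε) ∑_{x,y : f(y)<0 ≤ f(x)} w(x,y)(f(x)-f(y)), where f ∈ ℋ(P) for a connected salami partition P. -/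
open Filter

namespace SalamiPaper

variable {V : Type*}

section Distance

variable {w : V → V → ℝ}

/-- The combinatorial distance of distinct points in a path metric is realized by a path. -/
lemma exists_path_combDist_eq {x y : V} (h : 0 < combDist w x y) :
    ∃ (n : ℕ) (p : ℕ → V), p 0 = x ∧ p n = y ∧
      (∀ i < n, 0 < w (p i) (p (i + 1))) ∧ combDist w x y = (n : ℝ) := by
  set S : Set ℕ := {n | ∃ p : ℕ → V, p 0 = x ∧ p n = y ∧ ∀ i < n, 0 < w (p i) (p (i + 1))}
    with hS
  have hne : S.Nonempty := by
    by_contra hemp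
    rw [Set.not_nonempty_iff_eq_empty] at hemp
    have : combDist w x y = 0 := by
      unfold combDist
      convert Real.sInf_empty
      ext L
      simp only [Set.mem_ofPred_eq, Set.mem_empty_iff_false, iff_false]
      rintro ⟨n, p, h0, hn, hp, -⟩
      have : n ∈ S := ⟨p, h0, hn, hp⟩
      simp [hemp] at this
    exact h.ne' this
  obtain ⟨p, h0, hn, hp⟩ := Nat.sInf_mem hne
  refine ⟨sInf S, p, h0, hn, hp, ?_⟩
  refine IsLeast.csInf_eq ⟨⟨sInf S, p, h0, hn, hp, rfl⟩, ?_⟩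
  rintro L ⟨n, q, h0', hn', hq, rfl⟩
  exact_mod_cast Nat.sInf_le (show n ∈ S from ⟨q, h0', hn', hq⟩)

lemma combDist_le_of_path {x y : V} {n : ℕ} {p : ℕ → V} (h0 : p 0 = x) (hn : p n = y)
    (hp : ∀ i < n, 0 < w (p i) (p (i + 1))) : combDist w x y ≤ n := by
  refine csInf_le ⟨0, ?_⟩ ⟨n, p, h0, hn, hp, rfl⟩
  rintro L ⟨k, -, -, -, -, rfl⟩
  positivity

lemma combDist_le_one {x y : V} (h : 0 < w x y) : combDist w x y ≤ 1 := by
  have := combDist_le_of_path (w := w) (n := 1) (p := fun i => if i = 0 then x else y)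
    (x := x) (y := y) (by simp) (by simp) (by intro i hi; interval_cases i; simpa using h)
  simpa using this

/-- A first step of a geodesic decreases the combinatorial distance by one. -/
lemma exists_adj_combDist_le {x y : V} (h : 0 < combDist w x y) :
    ∃ z, 0 < w x z ∧ combDist w z y + 1 ≤ combDist w x y := by
  obtain ⟨n, p, h0, hn, hp, hd⟩ := exists_path_combDist_eq h
  obtain _ | n := n
  · simp [hd] at h
  refine ⟨p 1, h0 ▸ hp 0 n.succ_pos, ?_⟩
  have := combDist_le_of_path (w := w) (n := n) (p := fun i => p (i + 1)) (x := p 1) (y := y)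
    rfl hn (fun i hi => hp (i + 1) (by omega))
  rw [hd]
  push_cast
  linarith

end Distance

section Extension

variable {w d : V → V → ℝ} {Z K : Set V} {g : V → ℝ}

/-- On `Z`, the function `g` is the largest Lipschitz extension of its values on `K`. -/
def IsMaxExtension (d : V → V → ℝ) (Z K : Set V) (g : V → ℝ) : Prop :=
  ∀ v ∈ Z, (∃ u ∈ K, g v = g u + d v u) ∧ ∀ u ∈ K, g v ≤ g u + d v u

lemma IsMaxExtension.le_add_one (h : IsMaxExtension d Z K g)
    (htri : ∀ x y z, d x z ≤ d x y + d y z) {x y : V} (hx : x ∈ Z) (hy : y ∈ Z)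
    (hyx : d y x ≤ 1) : g y ≤ g x + 1 := by
  obtain ⟨u, hu, he⟩ := (h x hx).1
  linarith [(h y hy).2 u hu, htri y x u]

lemma IsMaxExtension.finite_le (h : IsMaxExtension d Z K g) (hK : K.Finite)
    (hsymm : ∀ x y, d x y = d y x) (hfin : FiniteBalls d) (b : ℝ) :
    {v ∈ Z | g v ≤ b}.Finite := by
  refine (hK.biUnion fun u _ => hfin u (b - g u)).subset ?_
  rintro v ⟨hv, hb⟩
  obtain ⟨u, hu, he⟩ := (h v hv).1
  simp only [Set.mem_iUnion, Set.mem_ofPred_eq]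
  exact ⟨u, hu, by rw [hsymm]; linarith⟩

lemma IsMaxExtension.exists_le (h : IsMaxExtension d Z K g) (hnn : ∀ x y, 0 ≤ d x y)
    {v : V} (hv : v ∈ Z) : ∃ u ∈ K, g u ≤ g v := by
  obtain ⟨u, hu, he⟩ := (h v hv).1
  exact ⟨u, hu, by linarith [hnn v u]⟩

lemma IsMaxExtension.exists_adj_add_one_le (h : IsMaxExtension (combDist w) Z K g)
    (hpos : ∀ x y, x ≠ y → 0 < combDist w x y) {v : V} (hv : v ∈ Z) (hvK : v ∉ K)
    (hadj : ∀ x, 0 < w v x → x ∈ Z) : ∃ x, 0 < w v x ∧ g x + 1 ≤ g v := by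
  obtain ⟨u, hu, he⟩ := (h v hv).1
  obtain ⟨x, hx, hd⟩ := exists_adj_combDist_le (hpos v u (by rintro rfl; exact hvK hu))
  exact ⟨x, hx, by linarith [(h x (hadj x hx)).2 u hu]⟩

/-- Above the values on `K`, every vertex has a neighbor lying lower by at least one. -/
lemma IsMaxExtension.exists_descent {X Y : Set V} (hK : K.Finite)
    (hY : IsMaxExtension (combDist w) (Y ∪ K) K g)
    (hX : IsMaxExtension (combDist w) (X ∪ K) K (-g))
    (huniv : X ∪ Y ∪ K = Set.univ) (hXY : ∀ x ∈ X, ∀ y ∈ Y, w y x = 0)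
    (hpos : ∀ x y, x ≠ y → 0 < combDist w x y) (hnn : ∀ x y, 0 ≤ combDist w x y) :
    ∃ C, ∀ v, C ≤ g v → ∃ x, 0 < w v x ∧ g x + 1 ≤ g v := by
  obtain ⟨C, hC⟩ := (hK.image g).bddAbove
  have hC' : ∀ u ∈ K, g u ≤ C := fun u hu => hC ⟨u, hu, rfl⟩
  refine ⟨C + 1, fun v hv => ?_⟩
  have hvXK : v ∉ X ∪ K := fun hvX => by
    obtain ⟨u, hu, hle⟩ := hX.exists_le hnn hvX
    simp only [Pi.neg_apply] at hle
    linarith [hC' u hu]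
  have hmem : ∀ x, x ∈ X ∨ x ∈ Y ∪ K := fun x => by
    have : x ∈ X ∪ Y ∪ K := huniv ▸ Set.mem_univ x
    rwa [Set.union_assoc] at this
  have hvX : v ∉ X := fun h => hvXK (Or.inl h)
  have hvK : v ∉ K := fun h => hvXK (Or.inr h)
  have hvYK := (hmem v).resolve_left hvX
  refine hY.exists_adj_add_one_le hpos hvYK hvK fun x hx => ?_
  exact (hmem x).resolve_left fun hxX => hx.ne' (hXY x hxX v (hvYK.resolve_right hvK))

end Extension

section CalF

variable {d : V → V → ℝ} {X Y K : Set V} {g : V → ℝ}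

lemma isMaxExtension_of_mem_calF (hg : g ∈ calF d X Y K) (hK : K.Finite) (hne : K.Nonempty)
    (hXY : Disjoint X Y) (h0 : ∀ x, d x x = 0) (hsymm : ∀ x y, d x y = d y x) :
    IsMaxExtension d (Y ∪ K) K g := by
  obtain ⟨f, hf, rfl⟩ := hg
  have hfK : ∀ u ∈ K, Sop d X Y K f u = f u := fun u hu => by simp [Sop, hu]
  intro v hv
  by_cases hvK : v ∈ K
  · refine ⟨⟨v, hvK, by simp [h0]⟩, fun u hu => ?_⟩
    rw [hfK v hvK, hfK u hu, hsymm]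
    linarith [hf u hu v hvK]
  · have hvX : v ∉ X := fun h => Set.disjoint_left.1 hXY h (hv.resolve_right hvK)
    set S : Set ℝ := {c | ∃ u ∈ K, c = f u + d v u} with hS
    have hSi : S = (fun u => f u + d v u) '' K := by
      ext c; simp [hS, eq_comm]
    have hSf : S.Finite := hSi ▸ hK.image _
    have hv' : Sop d X Y K f v = sInf S := by simp [Sop, hvK, hvX, hS]
    rw [hv']
    obtain ⟨u, hu, he⟩ := (hSi ▸ hne.image _ : S.Nonempty).csInf_mem hSf
    refine ⟨⟨u, hu, by rw [he, hfK u hu]⟩, fun u hu => ?_⟩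
    rw [hfK u hu]
    exact csInf_le hSf.bddBelow ⟨u, hu, rfl⟩

lemma isMaxExtension_neg_of_mem_calF (hg : g ∈ calF d X Y K) (hK : K.Finite)
    (hne : K.Nonempty) (h0 : ∀ x, d x x = 0) :
    IsMaxExtension d (X ∪ K) K (-g) := by
  obtain ⟨f, hf, rfl⟩ := hg
  have hfK : ∀ u ∈ K, Sop d X Y K f u = f u := fun u hu => by simp [Sop, hu]
  intro v hv
  simp only [Pi.neg_apply]
  by_cases hvK : v ∈ K
  · refine ⟨⟨v, hvK, by simp [h0]⟩, fun u hu => ?_⟩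
    rw [hfK v hvK, hfK u hu]
    linarith [hf v hvK u hu]
  · have hvX : v ∈ X := hv.resolve_right hvK
    set S : Set ℝ := {c | ∃ u ∈ K, c = f u - d v u} with hS
    have hSi : S = (fun u => f u - d v u) '' K := by
      ext c; simp [hS, eq_comm]
    have hSf : S.Finite := hSi ▸ hK.image _
    have hv' : Sop d X Y K f v = sSup S := by simp [Sop, hvK, hvX, hS]
    rw [hv']
    obtain ⟨u, hu, he⟩ := (hSi ▸ hne.image _ : S.Nonempty).csSup_mem hSf
    refine ⟨⟨u, hu, by rw [he, hfK u hu]; ring⟩, fun u hu => ?_⟩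
    rw [hfK u hu]
    linarith [le_csSup hSf.bddAbove (show f u - d v u ∈ S from ⟨u, hu, rfl⟩)]

end CalF

section Flux

variable {w : V → V → ℝ} {m g : V → ℝ}

lemma sum_eq_zero_of_lap_eq_zero {u : V → ℝ} {x : V} (hm : 0 < m x) (hu : lap w m u x = 0)
    {S : Finset V} (hS : ∀ y, w x y ≠ 0 → y ∈ S) : ∑ y ∈ S, w x y * (u y - u x) = 0 := by
  rw [← finsum_eq_sum_of_support_subset]
  · exact (mul_eq_zero.1 hu).resolve_left (inv_pos.2 hm).ne'
  · intro y hy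
    exact hS y (left_ne_zero_of_mul hy)

open Classical in
/-- The flux of `g` through the level `T`. -/
noncomputable def cutAt (w : V → V → ℝ) (g : V → ℝ) (T : ℝ) : ℝ :=
  ∑ᶠ p : V × V, if g p.2 < T ∧ T ≤ g p.1 then w p.1 p.2 * (g p.1 - g p.2) else 0

lemma cutSum_eq_cutAt_zero : cutSum w g = cutAt w g 0 := rfl

open Classical in
lemma cutAt_eq_sum (hsymm : ∀ x y, w x y = w y x) (hnn : ∀ x y, 0 ≤ w x y)
    (hlip : ∀ x y, 0 < w x y → g y ≤ g x + 1) {T : ℝ} {S : Finset V}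
    (hS : ∀ v, T - 1 ≤ g v → g v ≤ T + 1 → v ∈ S) :
    cutAt w g T =
      ∑ x ∈ S, ∑ y ∈ S, if g y < T ∧ T ≤ g x then w x y * (g x - g y) else 0 := by
  rw [← Finset.sum_product', cutAt, finsum_eq_sum_of_support_subset]
  rintro ⟨x, y⟩ hp
  simp only [Function.mem_support, ne_eq, ite_eq_right_iff, Classical.not_imp] at hp
  obtain ⟨⟨h1, h2⟩, h3⟩ := hp
  have hwp : 0 < w x y := (hnn x y).lt_of_ne' (left_ne_zero_of_mul h3)
  have := hlip y x (hsymm x y ▸ hwp)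
  simp only [Finset.coe_product, Set.mem_prod, Finset.mem_coe]
  exact ⟨hS x (by linarith) (by linarith), hS y (by linarith) (by linarith)⟩

open Classical in
lemma sum_superlevel_eq_cut (hsymm : ∀ x y, w x y = w y x) (T : ℝ) (S : Finset V) :
    (∑ x ∈ S, ∑ y ∈ S, if g y < T ∧ T ≤ g x then w x y * (g x - g y) else 0) =
      ∑ x ∈ S, ∑ y ∈ S, if T ≤ g x then w x y * (g x - g y) else 0 := by
  have hanti : (∑ x ∈ S, ∑ y ∈ S, if T ≤ g y ∧ T ≤ g x then w x y * (g x - g y) else 0) = 0 := by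
    have : (∑ x ∈ S, ∑ y ∈ S, if T ≤ g y ∧ T ≤ g x then w x y * (g x - g y) else 0) =
        -∑ x ∈ S, ∑ y ∈ S, if T ≤ g y ∧ T ≤ g x then w x y * (g x - g y) else 0 := by
      conv_lhs => rw [Finset.sum_comm]
      simp only [← Finset.sum_neg_distrib]
      refine Finset.sum_congr rfl fun x _ => Finset.sum_congr rfl fun y _ => ?_
      simp only [and_comm (a := T ≤ g x), hsymm y x]
      split_ifs <;> ring
    linarith
  refine (add_zero _).symm.trans ((congrArg (_ + ·) hanti.symm).trans ?_)
  simp only [← Finset.sum_add_distrib]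
  refine Finset.sum_congr rfl fun x _ => Finset.sum_congr rfl fun y _ => ?_
  by_cases h1 : T ≤ g x <;> by_cases h2 : T ≤ g y <;> simp [h1, h2, not_lt.2, not_le.1]

/-- The flux of a harmonic function with finite level bands does not depend on the level. -/
lemma cutAt_eq_cutAt (hsymm : ∀ x y, w x y = w y x) (hnn : ∀ x y, 0 ≤ w x y)
    (hm : ∀ x, 0 < m x) (hlip : ∀ x y, 0 < w x y → g y ≤ g x + 1)
    (hfin : ∀ a b, {v | a ≤ g v ∧ g v ≤ b}.Finite) (hharm : ∀ x, lap w m g x = 0)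
    {T₁ T₂ : ℝ} (hT : T₁ ≤ T₂) : cutAt w g T₁ = cutAt w g T₂ := by
  classical
  set S := (hfin (T₁ - 1) (T₂ + 1)).toFinset with hSdef
  have hS : ∀ v, T₁ - 1 ≤ g v → g v ≤ T₂ + 1 → v ∈ S := fun v h1 h2 => (Set.Finite.mem_toFinset _).2 ⟨h1, h2⟩
  rw [cutAt_eq_sum hsymm hnn hlip (S := S) fun v h1 h2 => hS v h1 (by linarith),
    cutAt_eq_sum hsymm hnn hlip (S := S) fun v h1 h2 => hS v (by linarith) h2,
    sum_superlevel_eq_cut hsymm, sum_superlevel_eq_cut hsymm]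
  refine Finset.sum_congr rfl fun x _ => ?_
  by_cases h2 : T₂ ≤ g x
  · simp [h2, hT.trans h2]
  by_cases h1 : T₁ ≤ g x
  · simp only [h1, h2, if_true, if_false, Finset.sum_const_zero]
    have := sum_eq_zero_of_lap_eq_zero (hm x) (hharm x) (S := S) fun y hy => by
      have hp : 0 < w x y := (hnn x y).lt_of_ne' hy
      have := hlip x y hp
      have := hlip y x (hsymm x y ▸ hp)
      push Not at h2
      exact hS y (by linarith) (by linarith)
    rw [← neg_eq_zero, ← this, ← Finset.sum_neg_distrib]
    exact Finset.sum_congr rfl fun y _ => by ring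
  · simp [h1, h2]

open Classical in
lemma cut_term_nonneg (hnn : ∀ x y, 0 ≤ w x y) (T : ℝ) (x y : V) :
    0 ≤ if g y < T ∧ T ≤ g x then w x y * (g x - g y) else 0 := by
  split_ifs with h
  · exact mul_nonneg (hnn x y) (by linarith)
  · exact le_rfl

/-- If every vertex of `B`, lying just above the level `T`, has a neighbor lower by one,
then the flux through `T` controls the size of `B`. -/
lemma card_mul_le_cutAt_of_above (hsymm : ∀ x y, w x y = w y x) (hnn : ∀ x y, 0 ≤ w x y)
    (hlip : ∀ x y, 0 < w x y → g y ≤ g x + 1)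
    (hfin : ∀ a b, {v | a ≤ g v ∧ g v ≤ b}.Finite)
    {ε : ℝ} (hw : ∀ x y, 0 < w x y → ε ≤ w x y) {T : ℝ} {B : Finset V}
    (hB : ∀ v ∈ B, T ≤ g v ∧ g v < T + 1) (hstep : ∀ v ∈ B, ∃ x, 0 < w v x ∧ g x + 1 ≤ g v) :
    (B.card : ℝ) * ε ≤ cutAt w g T := by
  classical
  set S := (hfin (T - 1) (T + 1)).toFinset with hSdef
  have hS : ∀ v, T - 1 ≤ g v → g v ≤ T + 1 → v ∈ S := fun v h1 h2 => (Set.Finite.mem_toFinset _).2 ⟨h1, h2⟩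
  rw [cutAt_eq_sum hsymm hnn hlip hS, ← nsmul_eq_mul, ← Finset.sum_const]
  have hBS : B ⊆ S := fun v hv => hS v (by linarith [(hB v hv).1]) (hB v hv).2.le
  refine (Finset.sum_le_sum fun v hv => ?_).trans
    (Finset.sum_le_sum_of_subset_of_nonneg hBS fun v _ _ =>
      Finset.sum_nonneg fun y _ => cut_term_nonneg hnn T v y)
  obtain ⟨hv1, hv2⟩ := hB v hv
  obtain ⟨x, hx, hle⟩ := hstep v hv
  have hxS : x ∈ S := hS x (by linarith [hlip x v (hsymm v x ▸ hx)]) (by linarith)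
  refine le_trans ?_ (Finset.single_le_sum (fun y _ => cut_term_nonneg hnn T v y) hxS)
  rw [if_pos ⟨by linarith, hv1⟩]
  nlinarith [hw v x hx]

/-- If every vertex of `B`, lying just below the level `T`, has a neighbor higher by one,
then the flux through `T` controls the size of `B`. -/
lemma card_mul_le_cutAt_of_below (hsymm : ∀ x y, w x y = w y x) (hnn : ∀ x y, 0 ≤ w x y)
    (hlip : ∀ x y, 0 < w x y → g y ≤ g x + 1)
    (hfin : ∀ a b, {v | a ≤ g v ∧ g v ≤ b}.Finite)
    {ε : ℝ} (hw : ∀ x y, 0 < w x y → ε ≤ w x y) {T : ℝ} {B : Finset V}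
    (hB : ∀ v ∈ B, T - 1 ≤ g v ∧ g v < T) (hstep : ∀ v ∈ B, ∃ x, 0 < w v x ∧ g v + 1 ≤ g x) :
    (B.card : ℝ) * ε ≤ cutAt w g T := by
  classical
  set S := (hfin (T - 1) (T + 1)).toFinset with hSdef
  have hS : ∀ v, T - 1 ≤ g v → g v ≤ T + 1 → v ∈ S := fun v h1 h2 => (Set.Finite.mem_toFinset _).2 ⟨h1, h2⟩
  rw [cutAt_eq_sum hsymm hnn hlip hS, ← nsmul_eq_mul, ← Finset.sum_const, Finset.sum_comm]
  have hBS : B ⊆ S := fun v hv => hS v (hB v hv).1 (by linarith [(hB v hv).2])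
  refine (Finset.sum_le_sum fun v hv => ?_).trans
    (Finset.sum_le_sum_of_subset_of_nonneg hBS fun v _ _ =>
      Finset.sum_nonneg fun y _ => cut_term_nonneg hnn T y v)
  obtain ⟨hv1, hv2⟩ := hB v hv
  obtain ⟨x, hx, hle⟩ := hstep v hv
  have hxS : x ∈ S := hS x (by linarith) (by linarith [hlip v x hx])
  refine le_trans ?_ (Finset.single_le_sum (fun y _ => cut_term_nonneg hnn T y v) hxS)
  rw [if_pos ⟨hv2, by linarith⟩]
  rw [hsymm x v]
  nlinarith [hw v x hx]

end Flux

section MaximumPrinciple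

variable {w : V → V → ℝ} {m u : V → ℝ}

lemma nonpos_of_harmonic_of_boundary_eq_zero (hnn : ∀ x y, 0 ≤ w x y) (hm : ∀ x, 0 < m x)
    (hlf : LocallyFinite w) (hconn : GraphConnected w) {D : Set V} (hD : D.Finite)
    (hDne : D ≠ Set.univ) (hu : ∀ x ∈ D, lap w m u x = 0)
    (hbd : ∀ x ∈ D, ∀ y, 0 < w x y → y ∉ D → u y = 0) : ∀ x ∈ D, u x ≤ 0 := by
  intro x hx
  obtain ⟨x₀, hx₀, hmax⟩ := Set.exists_max_image D u hD ⟨x, hx⟩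
  by_contra! hpos
  have hM : 0 < u x₀ := hpos.trans_le (hmax x hx)
  have hstep : ∀ a b, 0 < w a b → a ∈ D ∧ u a = u x₀ → b ∈ D ∧ u b = u x₀ := by
    rintro a b hab ⟨haD, ha⟩
    have hle : ∀ y, 0 < w a y → u y ≤ u x₀ := fun y hy => by
      by_cases hyD : y ∈ D
      · exact hmax y hyD
      · exact (hbd a haD y hy hyD).trans_le hM.le
    have hsum := sum_eq_zero_of_lap_eq_zero (hm a) (hu a haD) (S := (hlf a).toFinset)
      fun y hy => by simpa using (hnn a y).lt_of_ne' hy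
    have hzero := (Finset.sum_eq_zero_iff_of_nonpos fun y hy =>
      mul_nonpos_of_nonneg_of_nonpos (hnn a y)
        (by linarith [hle y (by simpa using hy)])).1 hsum b (by simpa using hab)
    have hub : u b = u x₀ := by
      have := (mul_eq_zero.1 hzero).resolve_left hab.ne'
      linarith
    refine ⟨?_, hub⟩
    by_contra hbD
    linarith [hbd a haD b hab hbD]
  refine hDne (Set.eq_univ_of_forall fun y => ?_)
  have : y ∈ D ∧ u y = u x₀ := by
    induction hconn x₀ y with
    | refl => exact ⟨hx₀, rfl⟩
    | tail _ hab ih => exact hstep _ _ hab ih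
  exact this.1

lemma lap_neg (x : V) : lap w m (-u) x = -lap w m u x := by
  simp only [lap, Pi.neg_apply]
  rw [← mul_neg, ← finsum_neg_distrib]
  congr 1
  exact finsum_congr fun y => by ring

/-- Harmonic functions on a finite set are determined by their boundary values. -/
lemma eq_zero_of_harmonic_of_boundary_eq_zero (hnn : ∀ x y, 0 ≤ w x y) (hm : ∀ x, 0 < m x)
    (hlf : LocallyFinite w) (hconn : GraphConnected w) {D : Set V} (hD : D.Finite)
    (hDne : D ≠ Set.univ) (hu : ∀ x ∈ D, lap w m u x = 0)
    (hbd : ∀ x ∈ D, ∀ y, 0 < w x y → y ∉ D → u y = 0) : ∀ x ∈ D, u x = 0 := by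
  intro x hx
  refine le_antisymm
    (nonpos_of_harmonic_of_boundary_eq_zero hnn hm hlf hconn hD hDne hu hbd x hx) ?_
  have := nonpos_of_harmonic_of_boundary_eq_zero (u := -u) hnn hm hlf hconn hD hDne
    (fun x hx => by rw [lap_neg, hu x hx, neg_zero])
    (fun x hx y hy hyD => by simp [hbd x hx y hy hyD]) x hx
  simpa using this

lemma lap_sum_smul (hlf : LocallyFinite w) (hnn : ∀ x y, 0 ≤ w x y) {ι : Type*} [Fintype ι]
    (c : ι → ℝ) (v : ι → V → ℝ) (x : V) :
    lap w m (∑ i, c i • v i) x = ∑ i, c i * lap w m (v i) x := by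
  have hsum : ∀ h : V → ℝ, ∑ᶠ y, w x y * (h y - h x) =
      ∑ y ∈ (hlf x).toFinset, w x y * (h y - h x) := fun h => by
    refine finsum_eq_sum_of_support_subset _ fun y hy => ?_
    simpa using (hnn x y).lt_of_ne' (left_ne_zero_of_mul hy)
  simp only [lap, hsum]
  simp only [Finset.sum_apply, Pi.smul_apply, smul_eq_mul, ← Finset.sum_sub_distrib,
    Finset.mul_sum]
  rw [Finset.sum_comm]
  exact Finset.sum_congr rfl fun i _ => Finset.sum_congr rfl fun y _ => by ring

end MaximumPrinciple

/-- Finitely many linearly independent functions remain independent on a large member of an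
exhaustion. -/
lemma exists_eq_zero_of_vanish {ι : Type*} [Fintype ι] {v : ι → V → ℝ}
    (hli : LinearIndependent ℝ v) {D : ℕ → Set V} (hD : Monotone D)
    (hcover : ∀ x, ∃ n, x ∈ D n) :
    ∃ N, ∀ n ≥ N, ∀ c : ι → ℝ, (∀ x ∈ D n, (∑ i, c i • v i) x = 0) → c = 0 := by
  let E : (ι → ℝ) →ₗ[ℝ] (V → ℝ) := Fintype.linearCombination ℝ v
  have hE : ∀ c, E c = ∑ i, c i • v i := fun c => Fintype.linearCombination_apply ℝ v c
  let N : ℕ → Submodule ℝ (ι → ℝ) := fun n =>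
    ⨅ x ∈ D n, LinearMap.ker ((LinearMap.proj x : (V → ℝ) →ₗ[ℝ] ℝ) ∘ₗ E)
  have hN : ∀ n c, c ∈ N n ↔ ∀ x ∈ D n, (∑ i, c i • v i) x = 0 := fun n c => by
    simp [N, hE, Submodule.mem_iInf]
  obtain ⟨k, hk⟩ := IsArtinian.monotone_stabilizes (R := ℝ) (M := ι → ℝ)
    ⟨fun n => OrderDual.toDual (N n), fun a b hab c hc => 
      (hN a c).2 fun x hx => (hN b c).1 hc x (hD hab hx)⟩
  have hk' : ∀ n ≥ k, N k = N n := fun n hn => hk n hn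
  refine ⟨k, fun n hn c hc => ?_⟩
  have hcn : c ∈ N k := hk' n hn ▸ (hN n c).2 hc
  have hzero : ∑ i, c i • v i = 0 := by
    ext x
    obtain ⟨j, hj⟩ := hcover x
    have : c ∈ N (max j k) := hk' _ (le_max_right _ _) ▸ hcn
    exact (hN _ c).1 this x (hD (le_max_left _ _) hj)
  exact funext fun i => Fintype.linearIndependent_iff.1 hli c hzero i

lemma InfVolume.ne_univ_of_finite {m : V → ℝ} {X D : Set V} (hX : InfVolume m X)
    (hm : ∀ x, 0 < m x) (hD : D.Finite) : D ≠ Set.univ := by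
  rintro rfl
  obtain ⟨F, -, hF⟩ := hX (∑ x ∈ hD.toFinset, m x)
  exact hF.not_ge (Finset.sum_le_sum_of_subset_of_nonneg (fun x _ => by simp)
    fun x _ _ => (hm x).le)

lemma InfVolume.nonempty {m : V → ℝ} {X : Set V} (hX : InfVolume m X) : X.Nonempty := by
  obtain ⟨F, hFX, hF⟩ := hX 0
  obtain ⟨x, hx⟩ : F.Nonempty := Finset.nonempty_of_sum_ne_zero hF.ne'
  exact ⟨x, hFX hx⟩

lemma SalamiPartition.nonempty {w : V → V → ℝ} {m : V → ℝ} {X Y K : Set V}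
    (hP : SalamiPartition w m X Y K) (hconn : GraphConnected w) : K.Nonempty := by
  obtain ⟨huniv, hXY, -, -, -, hw, hX, hY⟩ := hP
  by_contra hemp
  rw [Set.not_nonempty_iff_eq_empty] at hemp
  obtain ⟨x, hx⟩ := hX.nonempty
  obtain ⟨y, hy⟩ := hY.nonempty
  suffices y ∈ X from Set.disjoint_left.1 hXY this hy
  clear hy
  induction hconn x y with
  | refl => exact hx
  | @tail a b _ hab ih =>
    have hb : b ∈ X ∪ Y ∪ K := huniv ▸ Set.mem_univ b
    rw [hemp, Set.union_empty] at hb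
    exact hb.resolve_right fun hbY => hab.ne' (hw a ih b hbY)

/-- Dimension bound for harmonic functions in terms of the flux of a function with the
level structure of an extremal Lipschitz extension. -/
lemma card_le_of_level_structure {w : V → V → ℝ} {m g : V → ℝ}
    (hsymm : ∀ x y, w x y = w y x) (hnn : ∀ x y, 0 ≤ w x y) (hm : ∀ x, 0 < m x)
    (hlf : LocallyFinite w) (hconn : GraphConnected w)
    (hD : ∀ D : Set V, D.Finite → D ≠ Set.univ)
    (hlip : ∀ x y, 0 < w x y → g y ≤ g x + 1)
    (hfin : ∀ a b, {v | a ≤ g v ∧ g v ≤ b}.Finite) (hharm : ∀ x, lap w m g x = 0)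
    (hdown : ∃ C, ∀ v, C ≤ g v → ∃ x, 0 < w v x ∧ g x + 1 ≤ g v)
    (hup : ∃ C, ∀ v, g v ≤ C → ∃ x, 0 < w v x ∧ g v + 1 ≤ g x)
    {ε : ℝ} (hε : 0 < ε) (hw : ∀ x y, 0 < w x y → ε ≤ w x y)
    {ι : Type*} [Fintype ι] {v : ι → V → ℝ} (hv : ∀ i x, lap w m (v i) x = 0)
    (hli : LinearIndependent ℝ v) : (Fintype.card ι : ℝ) ≤ 2 / ε * cutAt w g 0 := by
  classical
  obtain ⟨C₁, hC₁⟩ := hdown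
  obtain ⟨C₂, hC₂⟩ := hup
  let D : ℕ → Set V := fun n => {x | -(n : ℝ) ≤ g x ∧ g x < n}
  have hDmono : Monotone D := fun a b hab x hx => by
    have : (a : ℝ) ≤ b := by exact_mod_cast hab
    exact ⟨by linarith [hx.1], by linarith [hx.2]⟩
  have hDcover : ∀ x, ∃ n, x ∈ D n := fun x => by
    obtain ⟨n, hn⟩ := exists_nat_gt |g x|
    obtain ⟨h1, h2⟩ := abs_lt.1 hn
    exact ⟨n, h1.le, h2⟩
  obtain ⟨N, hN⟩ := exists_eq_zero_of_vanish hli hDmono hDcover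
  obtain ⟨M, hM⟩ := exists_nat_gt (max C₁ (-C₂))
  set n := max N M with hn
  have hMn : (M : ℝ) ≤ n := by exact_mod_cast le_max_right N M
  have hnC₁ : C₁ ≤ n := by linarith [le_max_left C₁ (-C₂)]
  have hnC₂ : -(n : ℝ) ≤ C₂ := by linarith [le_max_right C₁ (-C₂)]
  have hDfin : (D n).Finite := (hfin (-n) n).subset fun x hx => ⟨hx.1, hx.2.le⟩
  set A : Finset V := (hfin n (n + 1)).toFinset.filter (fun x => g x < n + 1) with hA
  set B : Finset V := (hfin (-n - 1) (-n)).toFinset.filter (fun x => g x < -n) with hB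
  have hAmem : ∀ x, x ∈ A ↔ (n : ℝ) ≤ g x ∧ g x < n + 1 := fun x => by
    simp only [hA, Finset.mem_filter, Set.Finite.mem_toFinset, Set.mem_ofPred_eq]
    constructor
    · rintro ⟨⟨h1, -⟩, h2⟩; exact ⟨h1, h2⟩
    · rintro ⟨h1, h2⟩; exact ⟨⟨h1, h2.le⟩, h2⟩
  have hBmem : ∀ x, x ∈ B ↔ (-n - 1 : ℝ) ≤ g x ∧ g x < -n := fun x => by
    simp only [hB, Finset.mem_filter, Set.Finite.mem_toFinset, Set.mem_ofPred_eq]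
    constructor
    · rintro ⟨⟨h1, -⟩, h2⟩; exact ⟨h1, h2⟩
    · rintro ⟨h1, h2⟩; exact ⟨⟨h1, h2.le⟩, h2⟩
  have hAcard : (A.card : ℝ) * ε ≤ cutAt w g n :=
    card_mul_le_cutAt_of_above hsymm hnn hlip hfin hw (fun x hx => (hAmem x).1 hx)
      fun x hx => hC₁ x (hnC₁.trans ((hAmem x).1 hx).1)
  have hBcard : (B.card : ℝ) * ε ≤ cutAt w g (-n) :=
    card_mul_le_cutAt_of_below hsymm hnn hlip hfin hw (fun x hx => (hBmem x).1 hx)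
      fun x hx => hC₂ x (((hBmem x).1 hx).2.le.trans hnC₂)
  have hn0 : (0 : ℝ) ≤ n := n.cast_nonneg
  rw [← cutAt_eq_cutAt hsymm hnn hm hlip hfin hharm hn0] at hAcard
  rw [cutAt_eq_cutAt hsymm hnn hm hlip hfin hharm (neg_nonpos.2 hn0)] at hBcard
  let R : (ι → ℝ) →ₗ[ℝ] ((A ∪ B : Finset V) → ℝ) :=
    LinearMap.funLeft ℝ ℝ (Subtype.val : (A ∪ B : Finset V) → V) ∘ₗ
      Fintype.linearCombination ℝ v
  have hRinj : Function.Injective R := by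
    rw [injective_iff_map_eq_zero]
    intro c hc
    refine hN n (le_max_left _ _) c ?_
    have hc' : ∀ y ∈ A ∪ B, (∑ i, c i • v i) y = 0 := fun y hy => by
      have := congrFun hc ⟨y, hy⟩
      simpa [R, Fintype.linearCombination_apply] using this
    refine eq_zero_of_harmonic_of_boundary_eq_zero hnn hm hlf hconn hDfin (hD _ hDfin)
      (fun x _ => by rw [lap_sum_smul hlf hnn]; simp [hv]) fun x hx y hxy hyD => hc' y ?_
    have h1 := hlip x y hxy
    have h2 := hlip y x (hsymm x y ▸ hxy)
    rw [Finset.mem_union, hAmem, hBmem]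
    by_cases hy : (n : ℝ) ≤ g y
    · exact Or.inl ⟨hy, by linarith [hx.2]⟩
    · refine Or.inr ⟨by linarith [hx.1], ?_⟩
      by_contra! hlow
      exact hyD ⟨hlow, not_le.1 hy⟩
  have hcard : Fintype.card ι ≤ A.card + B.card := by
    have := LinearMap.finrank_le_finrank_of_injective hRinj
    simp only [Module.finrank_fintype_fun_eq_card, Fintype.card_coe] at this
    exact this.trans (Finset.card_union_le A B)
  have hcard' : (Fintype.card ι : ℝ) ≤ A.card + B.card := by exact_mod_cast hcard
  rw [div_mul_eq_mul_div, le_div_iff₀ hε]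
  nlinarith

/-- **Theorem (Finite dimension of the space of harmonic functions).** For a
salami with combinatorial distance and edge weights bounded below by `ε`,
the dimension of the space of all harmonic functions is at most
`(2/ε) ∑_{f(y)<0≤f(x)} w(x,y)(f(x)-f(y))`, where `f ∈ ℋ(P)` for a connected
salami partition `P`: any linearly independent finite family of harmonic
functions has cardinality at most this bound. -/
theorem salami_harmonic_finite_dimension {V : Type*} (w : V → V → ℝ) (m : V → ℝ)
    (hS : IsSalami w m (combDist w))
    (ε : ℝ) (hε : 0 < ε) (hw : ∀ x y, 0 < w x y → ε ≤ w x y)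
    (X Y K : Set V) (hP : ConnectedSalamiPartition w m X Y K)
    (f : V → ℝ) (hf : f ∈ calH w m (combDist w) X Y K)
    (s : Finset (V → ℝ)) (hharm : ∀ u ∈ s, ∀ x, lap w m u x = 0)
    (hli : LinearIndependent ℝ (fun u : {g : V → ℝ // g ∈ s} => (u : V → ℝ))) :
    (s.card : ℝ) ≤ (2 / ε) * cutSum w f := by
  obtain ⟨⟨-, hsymm, hnn, -, hm, hlf, hconn, ⟨hd0, hdpos, hdsymm, htri, -⟩, hballs⟩, -, -⟩ := hS
  have hdnn : ∀ x y, 0 ≤ combDist w x y := fun x y => by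
    obtain rfl | h := eq_or_ne x y
    · exact (hd0 x).ge
    · exact (hdpos x y h).le
  have hne := hP.1.nonempty hconn
  obtain ⟨⟨huniv, hXY, -, -, hK, hXYw, hXvol, -⟩, -⟩ := hP
  obtain ⟨hfF, hfharm⟩ := hf
  have hY := isMaxExtension_of_mem_calF hfF hK hne hXY hd0 hdsymm
  have hX := isMaxExtension_neg_of_mem_calF hfF hK hne hd0
  have hmem : ∀ x, x ∈ X ∨ x ∈ Y ∨ x ∈ K := fun x => by
    have : x ∈ X ∪ Y ∪ K := huniv ▸ Set.mem_univ x
    rwa [Set.union_assoc] at this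
  have hlip : ∀ x y, 0 < w x y → f y ≤ f x + 1 := fun x y hxy => by
    have hd : combDist w x y ≤ 1 := combDist_le_one hxy
    have hboth : (x ∈ Y ∪ K ∧ y ∈ Y ∪ K) ∨ (x ∈ X ∪ K ∧ y ∈ X ∪ K) := by
      rcases hmem x with hx | hx | hx <;> rcases hmem y with hy | hy | hy
      case inl.inr.inl => exact absurd (hXYw x hx y hy) hxy.ne'
      case inr.inl.inl => exact absurd (hsymm x y ▸ hXYw y hy x hx) hxy.ne'
      all_goals simp [hx, hy]
    rcases hboth with ⟨hx, hy⟩ | ⟨hx, hy⟩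
    · exact hY.le_add_one htri hx hy (hdsymm x y ▸ hd)
    · have := hX.le_add_one htri hy hx hd
      simp only [Pi.neg_apply] at this
      linarith
  have hfin : ∀ a b, {v | a ≤ f v ∧ f v ≤ b}.Finite := fun a b => by
    refine ((hY.finite_le hK hdsymm hballs b).union
      (hX.finite_le hK hdsymm hballs (-a))).subset fun v hv => ?_
    rcases hmem v with h | h
    · exact Or.inr ⟨Or.inl h, neg_le_neg hv.1⟩
    · exact Or.inl ⟨h, hv.2⟩
  have hdown := IsMaxExtension.exists_descent hK hY hX huniv
    (fun x hx y hy => hsymm x y ▸ hXYw x hx y hy) hdpos hdnn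
  have hup : ∃ C, ∀ v, f v ≤ C → ∃ x, 0 < w v x ∧ f v + 1 ≤ f x := by
    obtain ⟨C, hC⟩ := IsMaxExtension.exists_descent hK hX ((neg_neg f).symm ▸ hY)
      (Set.union_comm X Y ▸ huniv) (fun y hy x hx => hXYw x hx y hy) hdpos hdnn
    refine ⟨-C, fun v hv => ?_⟩
    obtain ⟨x, hx, hle⟩ := hC v (by simp only [Pi.neg_apply]; linarith)
    simp only [Pi.neg_apply] at hle
    exact ⟨x, hx, by linarith⟩
  have hcard := card_le_of_level_structure hsymm hnn hm hlf hconn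
    (fun D hD => hXvol.ne_univ_of_finite hm hD) hlip hfin hfharm hdown hup hε hw
    (v := fun u : {g : V → ℝ // g ∈ s} => (u : V → ℝ)) (fun u => hharm u u.2) hli
  rwa [Fintype.card_coe, ← cutSum_eq_cutAt_zero] at hcard

end SalamiPaper
end
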